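/- arXiv:2504.18656 — 4 statements merged into one kernel-verified Lean document; each statement's English description precedes it below -/
import Mathlib

section
/- Let F be a field, let a, b, c be nonnegative integers, and let M, K be positive integers with aK ≤ M and bK ≤ M. Assume either that F has characteristic 0, or that F has characteristic p for a prime p with min{ M + (c−a)K, M + (c−b)K, 2M − (a+b)K } ≤ p (as integers). Let f = x^a y^b (x+y)^c ∈ F[x,y] and let ℓ_{K,M} = dim_F F[x,y]/(x^M, y^M, f^K). Then: (a) if a ≥ b + c, then ℓ_{K,M} = (a+b+c)KM − a(b+c)K²; (b) if (a+b+c)K ≥ 2M, then ℓ_{K,M} = M²; (c) if b ≥ a + c, then ℓ_{K,M} = (a+b+c)KM − b(a+c)K²; (d) if none of (a), (b), (c) holds, then ℓ_{K,M} = (a+b+c)KM − ⌊(a+b+c)²K²/4⌋. -/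
open MvPolynomial

/-- The ideal `(x^M, y^M, (x^a y^b (x+y)^c)^K)` of `F[x,y]`. -/
noncomputable def IKM (F : Type*) [Field F] (a b c M K : ℕ) : Ideal (MvPolynomial (Fin 2) F) :=
  Ideal.span ({X 0 ^ M, X 1 ^ M, (X 0 ^ a * X 1 ^ b * (X 0 + X 1) ^ c) ^ K} :
    Set (MvPolynomial (Fin 2) F))

open scoped Polynomial

namespace Polynomial

variable {F : Type*} [Field F]

lemma mem_degreeLT_iff_natDegree_lt {n : ℕ} {q : F[X]} (hq : q ≠ 0) :
    q ∈ degreeLT F n ↔ q.natDegree < n := by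
  rw [mem_degreeLT, natDegree_lt_iff_degree_lt hq]

lemma mul_mem_degreeLT {n k : ℕ} {g q : F[X]} (hg : g.natDegree ≤ k)
    (hq : q ∈ degreeLT F (n - k)) : g * q ∈ degreeLT F n := by
  rcases eq_or_ne q 0 with rfl | hq0
  · simp
  rcases eq_or_ne g 0 with rfl | hg0
  · simp
  rw [mem_degreeLT_iff_natDegree_lt hq0] at hq
  rw [mem_degreeLT_iff_natDegree_lt (mul_ne_zero hg0 hq0), natDegree_mul hg0 hq0]
  omega

lemma mem_degreeLT_of_mul_mem {n : ℕ} {g q : F[X]} (hg : g ≠ 0)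
    (hq : g * q ∈ degreeLT F n) : q ∈ degreeLT F (n - g.natDegree) := by
  rcases eq_or_ne q 0 with rfl | hq0
  · simp
  rw [mem_degreeLT_iff_natDegree_lt (mul_ne_zero hg hq0), natDegree_mul hg hq0] at hq
  rw [mem_degreeLT_iff_natDegree_lt hq0]
  omega

lemma natDegree_one_add_X_pow (n : ℕ) : ((1 + X : F[X]) ^ n).natDegree = n := by
  rw [natDegree_pow, add_comm, ← C_1, natDegree_X_add_C, mul_one]

lemma one_add_X_ne_zero : (1 + X : F[X]) ≠ 0 := by
  rw [add_comm, ← C_1]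
  exact X_add_C_ne_zero 1

lemma isCoprime_X_one_add_X : IsCoprime (X : F[X]) (1 + X) :=
  ⟨-1, 1, by ring⟩

lemma coeff_X_mul_derivative (q : F[X]) (k : ℕ) :
    (X * derivative q).coeff k = k * q.coeff k := by
  cases k with
  | zero => simp
  | succ k => rw [coeff_X_mul, coeff_derivative]; push_cast; ring

lemma natDegree_X_mul_derivative_le (q : F[X]) : (X * derivative q).natDegree ≤ q.natDegree := by
  refine natDegree_le_iff_coeff_eq_zero.2 fun k hk => ?_
  rw [coeff_X_mul_derivative, coeff_eq_zero_of_natDegree_lt hk, mul_zero]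

lemma natDegree_cast_eq_of_wronskian_eq_zero {g h : F[X]} (hg : g ≠ 0) (hh : h ≠ 0)
    (hW : wronskian g h = 0) : (g.natDegree : F) = h.natDegree := by
  have hz : g * (X * derivative h) = (X * derivative g) * h := by
    rw [wronskian, sub_eq_zero] at hW
    linear_combination X * hW
  have hc := congrArg (coeff · (g.natDegree + h.natDegree)) hz
  beta_reduce at hc
  rw [coeff_mul_add_eq_of_natDegree_le le_rfl (natDegree_X_mul_derivative_le h),
    coeff_mul_add_eq_of_natDegree_le (natDegree_X_mul_derivative_le g) le_rfl,
    coeff_X_mul_derivative, coeff_X_mul_derivative] at hc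
  have h1 : g.coeff g.natDegree ≠ 0 := by simpa using hg
  have h2 : h.coeff h.natDegree ≠ 0 := by simpa using hh
  exact (mul_right_cancel₀ (mul_ne_zero h1 h2) (by linear_combination hc)).symm

/-- Two polynomials of small degree with vanishing Wronskian are proportional. -/
lemma exists_eq_C_mul_of_wronskian_eq_zero {n : ℕ}
    (hn : ∀ i < n, ∀ j < n, (i : F) = j → i = j) {g h : F[X]} (hh : h ≠ 0)
    (hgn : g ∈ degreeLT F n) (hhn : h ∈ degreeLT F n)
    (hW : wronskian g h = 0) : ∃ r : F, g = C r * h := by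
  rcases eq_or_ne g 0 with rfl | hg
  · exact ⟨0, by simp⟩
  have key : ∀ q : F[X], q ≠ 0 → q ∈ degreeLT F n → wronskian q h = 0 →
      q.natDegree = h.natDegree := fun q hq hqn hqW =>
    hn _ ((mem_degreeLT_iff_natDegree_lt hq).1 hqn) _ ((mem_degreeLT_iff_natDegree_lt hh).1 hhn)
      (natDegree_cast_eq_of_wronskian_eq_zero hq hh hqW)
  refine ⟨g.leadingCoeff / h.leadingCoeff, ?_⟩
  set r := g.leadingCoeff / h.leadingCoeff with hr
  have hl : h.leadingCoeff ≠ 0 := leadingCoeff_ne_zero.2 hh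
  have hr0 : r ≠ 0 := div_ne_zero (leadingCoeff_ne_zero.2 hg) hl
  by_contra hne
  have hsub : g - C r * h ≠ 0 := sub_ne_zero.2 hne
  have hdeg := key g hg hgn hW
  have hlt : (g - C r * h).degree < g.degree := by
    refine degree_sub_lt_left ?_ hg ?_
    · rw [degree_C_mul hr0, degree_eq_natDegree hg, degree_eq_natDegree hh, hdeg]
    · rw [leadingCoeff_mul, leadingCoeff_C, hr, div_mul_cancel₀ _ hl]
  have hW' : wronskian (g - C r * h) h = 0 := by
    rw [wronskian] at hW ⊢
    simp only [derivative_sub, derivative_mul, derivative_C]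
    linear_combination hW
  have hmem : g - C r * h ∈ degreeLT F n := by
    rw [← smul_eq_C_mul]
    exact sub_mem hgn (Submodule.smul_mem _ _ hhn)
  have := key _ hsub hmem hW'
  have := natDegree_lt_natDegree hsub hlt
  omega

lemma pow_pred_dvd_derivative {a q : F[X]} {n : ℕ} (h : a ^ n ∣ q) :
    a ^ (n - 1) ∣ derivative q := by
  obtain ⟨r, rfl⟩ := h
  rw [derivative_mul, derivative_pow]
  exact dvd_add (((dvd_mul_left _ _).mul_right _).mul_right _)
    (Dvd.dvd.mul_right (pow_dvd_pow a (Nat.sub_le n 1)) _)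

/-- Absence of syzygies of low degree among `x ^ P`, `y ^ Q`, `(x + y) ^ R`, in dehomogenized
form. -/
theorem eq_zero_of_low_degree_syzygy {P Q R N : ℕ}
    (hN : ∀ i < N, ∀ j < N, (i : F) = j → i = j) (hPQR : 2 * N ≤ P + Q + R)
    (hP : P ≤ Q + R) (hQ : Q ≤ P + R) (hR : R ≤ P + Q) {u v w : F[X]}
    (hu : u ∈ degreeLT F (N - P)) (hv : v ∈ degreeLT F (N - Q)) (hw : w ∈ degreeLT F (N - R))
    (h : X ^ P * u + v + (1 + X) ^ R * w = 0) : u = 0 ∧ v = 0 ∧ w = 0 := by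
  have hXP : (X : F[X]) ^ P ≠ 0 := pow_ne_zero _ X_ne_zero
  have hYR : (1 + X : F[X]) ^ R ≠ 0 := pow_ne_zero _ one_add_X_ne_zero
  have hgN : X ^ P * u ∈ degreeLT F N := mul_mem_degreeLT (natDegree_X_pow P).le hu
  have hhN : (1 + X) ^ R * w ∈ degreeLT F N := mul_mem_degreeLT (natDegree_one_add_X_pow R).le hw
  have hsum : v + X ^ P * u + (1 + X) ^ R * w = 0 := by linear_combination h
  have hWv : wronskian v (X ^ P * u) = wronskian (X ^ P * u) ((1 + X) ^ R * w) :=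
    wronskian_eq_of_sum_zero hsum
  have hu' : u ≠ 0 → P + u.natDegree < N := fun h0 => by
    have := (mem_degreeLT_iff_natDegree_lt h0).1 hu
    omega
  have hv' : v ≠ 0 → Q + v.natDegree < N := fun h0 => by
    have := (mem_degreeLT_iff_natDegree_lt h0).1 hv
    omega
  have hw' : w ≠ 0 → R + w.natDegree < N := fun h0 => by
    have := (mem_degreeLT_iff_natDegree_lt h0).1 hw
    omega
  have hw0 : w = 0 → u = 0 ∧ v = 0 ∧ w = 0 := by
    rintro rfl
    have hvu : v = -(X ^ P * u) := by linear_combination h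
    rcases eq_or_ne u 0 with rfl | hu0
    · simpa using hvu
    have hv0 : v ≠ 0 := by rw [hvu]; exact neg_ne_zero.2 (mul_ne_zero hXP hu0)
    have h1 := hv' hv0
    rw [hvu, natDegree_neg, natDegree_mul hXP hu0, natDegree_X_pow] at h1
    omega
  by_cases hw1 : w = 0
  · exact hw0 hw1
  exfalso
  have hw2 := hw' hw1
  by_cases hW : wronskian (X ^ P * u) ((1 + X) ^ R * w) = 0
  · obtain ⟨r, hr⟩ := exists_eq_C_mul_of_wronskian_eq_zero hN (mul_ne_zero hYR hw1) hgN hhN hW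
    rcases eq_or_ne r 0 with rfl | hr0
    · rw [C_0, zero_mul] at hr
      have hvw : v = -((1 + X) ^ R * w) := by linear_combination h - hr
      have hv0 : v ≠ 0 := by rw [hvw]; exact neg_ne_zero.2 (mul_ne_zero hYR hw1)
      have h1 := hv' hv0
      rw [hvw, natDegree_neg, natDegree_mul hYR hw1, natDegree_one_add_X_pow] at h1
      omega
    · have hdvd : X ^ P ∣ w := by
        have hcop : IsCoprime ((X : F[X]) ^ P) ((1 + X) ^ R) := isCoprime_X_one_add_X.pow
        refine hcop.dvd_of_dvd_mul_left ⟨C r⁻¹ * u, ?_⟩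
        have hC : C r⁻¹ * C r = (1 : F[X]) := by rw [← C_mul, inv_mul_cancel₀ hr0, C_1]
        linear_combination -C r⁻¹ * hr - (1 + X) ^ R * w * hC
      have := natDegree_le_of_dvd hdvd hw1
      rw [natDegree_X_pow] at this
      omega
  · have hWv0 : wronskian v (X ^ P * u) ≠ 0 := hWv ▸ hW
    have hv0 : v ≠ 0 := by rintro rfl; simp at hWv0
    have hu0 : u ≠ 0 := by rintro rfl; simp at hWv0
    have h1 := natDegree_wronskian_lt_add hWv0
    rw [natDegree_mul hXP hu0, natDegree_X_pow] at h1
    have hdX : X ^ (P - 1) ∣ wronskian (X ^ P * u) ((1 + X) ^ R * w) :=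
      dvd_sub (((pow_dvd_pow X (Nat.sub_le P 1)).trans (dvd_mul_right _ u)).mul_right _)
        ((pow_pred_dvd_derivative (dvd_mul_right _ u)).mul_right _)
    have hdY : (1 + X) ^ (R - 1) ∣ wronskian (X ^ P * u) ((1 + X) ^ R * w) :=
      dvd_sub ((pow_pred_dvd_derivative (dvd_mul_right _ w)).mul_left _)
        (((pow_dvd_pow (1 + X) (Nat.sub_le R 1)).trans (dvd_mul_right _ w)).mul_left _)
    have hd := natDegree_le_of_dvd (isCoprime_X_one_add_X.pow.mul_dvd hdX hdY) hW
    rw [natDegree_mul (pow_ne_zero _ X_ne_zero) (pow_ne_zero _ one_add_X_ne_zero),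
      natDegree_X_pow, natDegree_one_add_X_pow, ← hWv] at hd
    have h2 := hu' hu0
    have h3 := hv' hv0
    omega

/-- The algebra map `x ↦ X s`, `y ↦ s` into `F[X][s]`: the coefficient of `s ^ e` is the
dehomogenization of the component of degree `e`. -/
noncomputable def grading (F : Type*) [Field F] : MvPolynomial (Fin 2) F →ₐ[F] F[X][X] :=
  MvPolynomial.aeval ![C X * X, X]

lemma grading_monomial (s : Fin 2 →₀ ℕ) (r : F) :
    grading F (MvPolynomial.monomial s r) = monomial (s 0 + s 1) (monomial (s 0) r) := by
  rw [grading, MvPolynomial.aeval_monomial, Finsupp.prod_fintype _ _ (by simp)]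
  simp only [Fin.prod_univ_two, Matrix.cons_val_zero, Matrix.cons_val_one, mul_pow, ← C_pow,
    ← C_mul_X_pow_eq_monomial, IsScalarTower.algebraMap_apply F F[X] F[X][X], algebraMap_eq, C_mul]
  ring

lemma coeff_grading_mem (r : MvPolynomial (Fin 2) F) (e : ℕ) :
    (grading F r).coeff e ∈ degreeLT F (e + 1) := by
  induction r using MvPolynomial.induction_on' with
  | monomial s c =>
    rw [grading_monomial, coeff_monomial]
    split_ifs with h
    · rw [mem_degreeLT]
      refine (degree_monomial_le _ _).trans_lt ?_
      exact_mod_cast (by omega : s 0 < e + 1)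
    · exact zero_mem _
  | add p q hp hq =>
    rw [map_add, coeff_add]
    exact add_mem hp hq

lemma sum_homogenize_coeff_grading (r : MvPolynomial (Fin 2) F) :
    (grading F r).sum (fun e q => q.homogenize e) = r := by
  induction r using MvPolynomial.induction_on' with
  | monomial s c =>
    rw [grading_monomial, sum_monomial_index _ _ (homogenize_zero _),
      homogenize_monomial (Nat.le_add_right _ _)]
    congr 2
    ext i
    fin_cases i <;> simp
  | add p q hp hq =>
    rw [map_add, sum_add_index _ _ _ homogenize_zero (by simp), hp, hq]

lemma grading_homogenize {q : F[X]} {e : ℕ} (hq : q.natDegree ≤ e) :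
    grading F (q.homogenize e) = monomial e q := by
  refine induction_with_natDegree_le
    (fun q => grading F (q.homogenize e) = monomial e q) e (by simp) ?_ ?_ q hq
  · intro n r _ hn
    rw [C_mul_X_pow_eq_monomial, homogenize_monomial hn, grading_monomial]
    simp [hn]
  · intro p q _ _ hp hq
    rw [homogenize_add, map_add, hp, hq, map_add]

lemma natDegree_le_of_mem_degreeLT {q : F[X]} {e : ℕ} (hq : q ∈ degreeLT F (e + 1)) :
    q.natDegree ≤ e := by
  rcases eq_or_ne q 0 with rfl | h
  · simp
  · exact Nat.lt_succ_iff.1 ((mem_degreeLT_iff_natDegree_lt h).1 hq)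

/-- The map `(u, v, w) ↦ X ^ M u + v + g w` on triples of polynomials of degrees less than
`i`, `j`, `k`. -/
noncomputable def comboMap (g : F[X]) (M i j k : ℕ) :
    degreeLT F i × degreeLT F j × degreeLT F k →ₗ[F] F[X] :=
  (LinearMap.mulLeft F (X ^ M) ∘ₗ (degreeLT F i).subtype).coprod
    ((degreeLT F j).subtype.coprod (LinearMap.mulLeft F g ∘ₗ (degreeLT F k).subtype))

lemma mem_range_comboMap {g q : F[X]} {M i j k : ℕ} :
    q ∈ LinearMap.range (comboMap g M i j k) ↔ ∃ u ∈ degreeLT F i, ∃ v ∈ degreeLT F j,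
      ∃ w ∈ degreeLT F k, X ^ M * u + v + g * w = q := by
  simp [comboMap, LinearMap.mem_range, add_assoc]

lemma comboMap_injective {g : F[X]} {M i j k : ℕ}
    (h : ∀ u ∈ degreeLT F i, ∀ v ∈ degreeLT F j, ∀ w ∈ degreeLT F k,
      X ^ M * u + v + g * w = 0 → u = 0 ∧ v = 0 ∧ w = 0) :
    Function.Injective (comboMap g M i j k) := by
  rw [← LinearMap.ker_eq_bot, LinearMap.ker_eq_bot']
  rintro ⟨⟨u, hu⟩, ⟨v, hv⟩, ⟨w, hw⟩⟩ h0
  have := h u hu v hv w hw (by simpa [comboMap, add_assoc] using h0)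
  simpa using this

lemma finrank_degreeLT (n : ℕ) : Module.finrank F (degreeLT F n) = n := by
  rw [(degreeLTEquiv F n).finrank_eq, Module.finrank_fin_fun]

instance (n : ℕ) : FiniteDimensional F (degreeLT F n) :=
  Module.Finite.equiv (degreeLTEquiv F n).symm

lemma finrank_range_comboMap {g : F[X]} {M i j k : ℕ}
    (h : Function.Injective (comboMap g M i j k)) :
    Module.finrank F (LinearMap.range (comboMap g M i j k)) = i + j + k := by
  rw [LinearMap.finrank_range_of_inj h, Module.finrank_prod, Module.finrank_prod,
    finrank_degreeLT, finrank_degreeLT, finrank_degreeLT, add_assoc]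

/-- The component of degree `N - 1` of the ideal `(x ^ M, y ^ M, g)`, where `g` is homogeneous
of degree `S`, in dehomogenized form. -/
noncomputable def idealPiece (g : F[X]) (M S N : ℕ) : Submodule F F[X] :=
  LinearMap.range (comboMap g M (N - M) (N - M) (N - S))

/-- The ideal `(x ^ M, y ^ M, g)`, where `g` is homogeneous of degree `S`. -/
noncomputable def powIdeal (g : F[X]) (M S : ℕ) : Ideal (MvPolynomial (Fin 2) F) :=
  Ideal.span {MvPolynomial.X 0 ^ M, MvPolynomial.X 1 ^ M, g.homogenize S}

lemma coeff_mul_grading_mem (r : MvPolynomial (Fin 2) F) {g : F[X]} {S : ℕ}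
    (hg : g.natDegree ≤ S) (e : ℕ) :
    ∃ w ∈ degreeLT F (e + 1 - S), (grading F (r * g.homogenize S)).coeff e = g * w := by
  rw [map_mul, grading_homogenize hg, ← C_mul_X_pow_eq_monomial, ← mul_assoc, coeff_mul_X_pow',
    coeff_mul_C]
  split_ifs with h
  · refine ⟨(grading F r).coeff (e - S), ?_, mul_comm _ _⟩
    rw [Nat.sub_add_comm h]
    exact coeff_grading_mem _ _
  · exact ⟨0, zero_mem _, (mul_zero g).symm⟩

lemma homogenize_X_pow_self (M : ℕ) :
    (X ^ M : F[X]).homogenize M = MvPolynomial.X 0 ^ M := by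
  rw [homogenize_X_pow le_rfl, Nat.sub_self, pow_zero, mul_one]

lemma homogenize_mul_mem {J : Ideal (MvPolynomial (Fin 2) F)} {g w : F[X]} {S e : ℕ}
    (hg : g.natDegree ≤ S) (hw : w ∈ degreeLT F (e + 1 - S)) (hJ : g.homogenize S ∈ J) :
    (g * w).homogenize e ∈ J := by
  rcases eq_or_ne w 0 with rfl | hw0
  · simp
  rw [mem_degreeLT_iff_natDegree_lt hw0] at hw
  obtain ⟨d, rfl⟩ := Nat.exists_eq_add_of_le (by omega : S ≤ e)
  rw [homogenize_mul _ _ hg (by omega)]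
  exact J.mul_mem_right _ hJ

lemma mem_powIdeal_iff {g : F[X]} {M S : ℕ} (hg : g.natDegree ≤ S)
    (r : MvPolynomial (Fin 2) F) :
    r ∈ powIdeal g M S ↔ ∀ e, (grading F r).coeff e ∈ idealPiece g M S (e + 1) := by
  constructor
  · intro hr e
    obtain ⟨a, b, c, rfl⟩ := Submodule.mem_span_triple.1 hr
    rw [smul_eq_mul, smul_eq_mul, smul_eq_mul, ← homogenize_X_pow_self, ← homogenize_one]
    obtain ⟨u, hu, hu'⟩ := coeff_mul_grading_mem a (natDegree_X_pow (R := F) M).le e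
    obtain ⟨v, hv, hv'⟩ := coeff_mul_grading_mem b ((natDegree_one (R := F)).trans_le M.zero_le) e
    obtain ⟨w, hw, hw'⟩ := coeff_mul_grading_mem c hg e
    rw [map_add, map_add, coeff_add, coeff_add, hu', hv', hw', one_mul]
    exact mem_range_comboMap.2 ⟨u, hu, v, hv, w, hw, rfl⟩
  · intro h
    rw [← sum_homogenize_coeff_grading r]
    refine Ideal.sum_mem _ fun e _ => ?_
    obtain ⟨u, hu, v, hv, w, hw, h'⟩ := mem_range_comboMap.1 (h e)
    beta_reduce
    rw [← h', homogenize_add, homogenize_add]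
    refine add_mem (add_mem ?_ ?_) ?_
    · refine homogenize_mul_mem (natDegree_X_pow M).le hu (Ideal.subset_span ?_)
      simp
    · rw [← one_mul v]
      refine homogenize_mul_mem (natDegree_one.trans_le M.zero_le) hv (Ideal.subset_span ?_)
      simp
    · exact homogenize_mul_mem hg hw (Ideal.subset_span (by simp))

lemma idealPiece_le {g : F[X]} {M S N : ℕ} (hg : g.natDegree ≤ S) :
    idealPiece g M S N ≤ degreeLT F N := by
  intro q hq
  obtain ⟨u, hu, v, hv, w, hw, rfl⟩ := mem_range_comboMap.1 hq
  exact add_mem (add_mem (mul_mem_degreeLT (natDegree_X_pow M).le hu)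
    (degreeLT_mono (Nat.sub_le _ _) hv)) (mul_mem_degreeLT hg hw)

lemma idealPiece_mono {g : F[X]} {M S N N' : ℕ} (h : N ≤ N') :
    idealPiece g M S N ≤ idealPiece g M S N' := by
  intro q hq
  obtain ⟨u, hu, v, hv, w, hw, rfl⟩ := mem_range_comboMap.1 hq
  exact mem_range_comboMap.2 ⟨u, degreeLT_mono (by omega) hu, v, degreeLT_mono (by omega) hv,
    w, degreeLT_mono (by omega) hw, rfl⟩

lemma X_mul_mem_degreeLT {q : F[X]} {n : ℕ} (hq : q ∈ degreeLT F n) :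
    X * q ∈ degreeLT F (n + 1) :=
  mul_mem_degreeLT (k := 1) natDegree_X_le (by simpa using hq)

lemma X_mul_mem_degreeLT_sub {q : F[X]} {N k : ℕ} (hq : q ∈ degreeLT F (N - k)) :
    X * q ∈ degreeLT F (N + 1 - k) := by
  rcases le_or_gt k N with h | h
  · rw [Nat.sub_add_comm h]
    exact X_mul_mem_degreeLT hq
  · rw [Nat.sub_eq_zero_of_le h.le] at hq
    have : q = 0 := by simpa [mem_degreeLT] using hq
    simp [this]

lemma X_mul_mem_idealPiece {g q : F[X]} {M S N : ℕ} (hq : q ∈ idealPiece g M S N) :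
    X * q ∈ idealPiece g M S (N + 1) := by
  obtain ⟨u, hu, v, hv, w, hw, rfl⟩ := mem_range_comboMap.1 hq
  exact mem_range_comboMap.2 ⟨X * u, X_mul_mem_degreeLT_sub hu, X * v, X_mul_mem_degreeLT_sub hv,
    X * w, X_mul_mem_degreeLT_sub hw, by ring⟩

lemma degreeLT_le_idealPiece_succ {g : F[X]} {M S N : ℕ} (hN : 0 < N)
    (h : degreeLT F N ≤ idealPiece g M S N) :
    degreeLT F (N + 1) ≤ idealPiece g M S (N + 1) := by
  intro q hq
  rw [← divX_mul_X_add q, mul_comm]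
  refine add_mem (X_mul_mem_idealPiece (h ?_)) (idealPiece_mono N.le_succ (h ?_))
  · rcases eq_or_ne q.divX 0 with h0 | h0
    · simp [h0]
    rw [mem_degreeLT_iff_natDegree_lt h0, natDegree_divX_eq_natDegree_tsub_one]
    have := natDegree_le_of_mem_degreeLT hq
    omega
  · rw [mem_degreeLT]
    exact degree_C_le.trans_lt (by exact_mod_cast hN)

lemma degreeLT_le_idealPiece_of_le {g : F[X]} {M S N N' : ℕ} (hN : 0 < N)
    (h : degreeLT F N ≤ idealPiece g M S N) (hNN' : N ≤ N') :
    degreeLT F N' ≤ idealPiece g M S N' := by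
  induction N', hNN' using Nat.le_induction with
  | base => exact h
  | succ n hn ih => exact degreeLT_le_idealPiece_succ (hN.trans_le hn) ih

/-- The dehomogenized component of degree `e`. -/
noncomputable def gradedComponent (F : Type*) [Field F] (e : ℕ) :
    MvPolynomial (Fin 2) F →ₗ[F] degreeLT F (e + 1) where
  toFun r := ⟨(grading F r).coeff e, coeff_grading_mem r e⟩
  map_add' p q := by ext1; simp
  map_smul' c p := by ext1; simp

/-- The map sending a polynomial to its components of degree less than `E`, modulo an ideal. -/
noncomputable def truncation (g : F[X]) (M S E : ℕ) :
    MvPolynomial (Fin 2) F →ₗ[F]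
      ((e : Fin E) → degreeLT F (e + 1) ⧸
        (idealPiece g M S (e + 1)).submoduleOf (degreeLT F (e + 1))) :=
  LinearMap.pi fun e => Submodule.mkQ _ ∘ₗ gradedComponent F e

lemma truncation_surjective (g : F[X]) (M S E : ℕ) :
    Function.Surjective (truncation g M S E) := by
  intro y
  choose q hq using fun e => Submodule.mkQ_surjective _ (y e)
  refine ⟨∑ e, (q e).1.homogenize e, ?_⟩
  ext1 e
  rw [← hq e]
  simp only [truncation, LinearMap.pi_apply, LinearMap.comp_apply]
  congr 1
  ext1
  change (grading F (∑ e, (q e).1.homogenize e)).coeff e = q e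
  rw [map_sum, finsetSum_coeff, Finset.sum_eq_single e]
  · rw [grading_homogenize (natDegree_le_of_mem_degreeLT (q e).2), coeff_monomial_same]
  · intro e' _ he
    rw [grading_homogenize (natDegree_le_of_mem_degreeLT (q e').2), coeff_monomial_of_ne]
    simpa [Fin.ext_iff] using he.symm
  · simp

lemma ker_truncation {g : F[X]} {M S E : ℕ} (hg : g.natDegree ≤ S)
    (hE : degreeLT F (E + 1) ≤ idealPiece g M S (E + 1)) :
    LinearMap.ker (truncation g M S E) = (powIdeal g M S).restrictScalars F := by
  ext r
  rw [LinearMap.mem_ker, Submodule.restrictScalars_mem, mem_powIdeal_iff hg, funext_iff]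
  have key : ∀ e : Fin E, truncation g M S E r e = 0 ↔
      (grading F r).coeff e ∈ idealPiece g M S (e + 1) := fun e => by
    rw [truncation, LinearMap.pi_apply, LinearMap.comp_apply, Submodule.mkQ_apply,
      Submodule.Quotient.mk_eq_zero]
    rfl
  constructor
  · intro h e
    rcases lt_or_ge e E with he | he
    · exact (key ⟨e, he⟩).1 (h ⟨e, he⟩)
    · exact degreeLT_le_idealPiece_of_le E.succ_pos hE (by omega) (coeff_grading_mem r e)
  · exact fun h e => (key e).2 (h e)

/-- Surjective linear maps with the same kernel have isomorphic targets. -/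
noncomputable def equivOfKerEq {V W₁ W₂ : Type*} [AddCommGroup V] [AddCommMonoid W₁]
    [AddCommMonoid W₂] [Module F V] [Module F W₁] [Module F W₂] (f₁ : V →ₗ[F] W₁)
    (f₂ : V →ₗ[F] W₂) (h₁ : Function.Surjective f₁) (h₂ : Function.Surjective f₂)
    (h : LinearMap.ker f₁ = LinearMap.ker f₂) : W₁ ≃ₗ[F] W₂ :=
  letI := Module.addCommMonoidToAddCommGroup F (M := W₁)
  letI := Module.addCommMonoidToAddCommGroup F (M := W₂)
  (f₁.quotKerEquivOfSurjective h₁).symm ≪≫ₗ Submodule.quotEquivOfEq _ _ h ≪≫ₗ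
    f₂.quotKerEquivOfSurjective h₂

/-- The quotient by a homogeneous ideal containing all forms of degree `E` splits into its
components of degree less than `E`. -/
noncomputable def quotientEquivPi {g : F[X]} {M S E : ℕ} (hg : g.natDegree ≤ S)
    (hE : degreeLT F (E + 1) ≤ idealPiece g M S (E + 1)) :
    (MvPolynomial (Fin 2) F ⧸ powIdeal g M S) ≃ₗ[F]
      ((e : Fin E) → degreeLT F (e + 1) ⧸
        (idealPiece g M S (e + 1)).submoduleOf (degreeLT F (e + 1))) :=
  equivOfKerEq ((powIdeal g M S).mkQ.restrictScalars F) (truncation g M S E)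
    (powIdeal g M S).mkQ_surjective (truncation_surjective g M S E)
    (.trans (by rw [LinearMap.ker_restrictScalars, Submodule.ker_mkQ]) (ker_truncation hg hE).symm)

lemma finiteDimensional_quotient_powIdeal {g : F[X]} {M S E : ℕ} (hg : g.natDegree ≤ S)
    (hE : degreeLT F (E + 1) ≤ idealPiece g M S (E + 1)) :
    FiniteDimensional F (MvPolynomial (Fin 2) F ⧸ powIdeal g M S) :=
  Module.Finite.equiv (quotientEquivPi hg hE).symm

lemma finrank_pi_quotient_add {ι : Type*} [Fintype ι] (V : ι → Type*) [∀ i, AddCommGroup (V i)]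
    [∀ i, Module F (V i)] [∀ i, FiniteDimensional F (V i)] (W : ∀ i, Submodule F (V i)) :
    Module.finrank F ((i : ι) → V i ⧸ W i) + ∑ i, Module.finrank F (W i) =
      ∑ i, Module.finrank F (V i) := by
  rw [Module.finrank_pi_fintype, ← Finset.sum_add_distrib]
  exact Finset.sum_congr rfl fun i _ => Submodule.finrank_quotient_add_finrank (W i)

lemma finrank_quotient_powIdeal_add {g : F[X]} {M S E : ℕ} (hg : g.natDegree ≤ S)
    (hE : degreeLT F (E + 1) ≤ idealPiece g M S (E + 1)) :
    Module.finrank F (MvPolynomial (Fin 2) F ⧸ powIdeal g M S) +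
      ∑ e ∈ Finset.range E, Module.finrank F (idealPiece g M S (e + 1)) =
      ∑ e ∈ Finset.range E, (e + 1) := by
  have h := finrank_pi_quotient_add (F := F) (fun e : Fin E => degreeLT F (e + 1))
    fun e => (idealPiece g M S (e + 1)).submoduleOf (degreeLT F (e + 1))
  rw [← (quotientEquivPi hg hE).finrank_eq] at h
  simp only [(Submodule.submoduleOfEquivOfLe (idealPiece_le hg)).finrank_eq, finrank_degreeLT] at h
  rwa [← Fin.sum_univ_eq_sum_range, ← Fin.sum_univ_eq_sum_range]

lemma range_comboMap_le_idealPiece {g : F[X]} {M S N i j k : ℕ}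
    (hi : i ≤ N - M) (hj : j ≤ N - M) (hk : k ≤ N - S) :
    LinearMap.range (comboMap g M i j k) ≤ idealPiece g M S N := by
  intro q hq
  obtain ⟨u, hu, v, hv, w, hw, rfl⟩ := mem_range_comboMap.1 hq
  exact mem_range_comboMap.2
    ⟨u, degreeLT_mono hi hu, v, degreeLT_mono hj hv, w, degreeLT_mono hk hw, rfl⟩

lemma degreeLT_le_idealPiece_of_injective {g : F[X]} {M S N i j k : ℕ} (hg : g.natDegree ≤ S)
    (hi : i ≤ N - M) (hj : j ≤ N - M) (hk : k ≤ N - S) (hijk : i + j + k = N)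
    (h : Function.Injective (comboMap g M i j k)) :
    degreeLT F N ≤ idealPiece g M S N := by
  have hle := range_comboMap_le_idealPiece (g := g) hi hj hk
  refine le_trans (le_of_eq ?_) hle
  refine (Submodule.eq_of_le_of_finrank_eq (hle.trans (idealPiece_le hg)) ?_).symm
  rw [finrank_range_comboMap h, finrank_degreeLT, hijk]

lemma eq_zero_of_X_pow_dvd {q : F[X]} {n : ℕ} (hq : q ∈ degreeLT F n) (h : X ^ n ∣ q) : q = 0 := by
  by_contra h0
  have h1 := natDegree_le_of_dvd h h0
  rw [natDegree_X_pow] at h1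
  have h2 := (mem_degreeLT_iff_natDegree_lt h0).1 hq
  omega

lemma comboMap_injective_of_le (g : F[X]) {M i j : ℕ} (hj : j ≤ M) :
    Function.Injective (comboMap g M i j 0) := by
  refine comboMap_injective fun u _ v hv w hw h => ?_
  have hw0 : w = 0 := by simpa [mem_degreeLT] using hw
  subst hw0
  have hv0 : v = 0 := eq_zero_of_X_pow_dvd (degreeLT_mono hj hv) ⟨-u, by linear_combination h⟩
  subst hv0
  simpa [X_ne_zero] using h

lemma degreeLT_two_mul_le_idealPiece {g : F[X]} {M S : ℕ} (hg : g.natDegree ≤ S) :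
    degreeLT F (2 * M) ≤ idealPiece g M S (2 * M) :=
  degreeLT_le_idealPiece_of_injective (i := M) (j := M) (k := 0) hg (by omega) (by omega)
    (by omega) (by omega) (comboMap_injective_of_le g le_rfl)

lemma natDegree_X_pow_mul_one_add_X_pow (A C : ℕ) :
    ((X : F[X]) ^ A * (1 + X) ^ C).natDegree = A + C := by
  rw [natDegree_mul (pow_ne_zero _ X_ne_zero) (pow_ne_zero _ one_add_X_ne_zero), natDegree_X_pow,
    natDegree_one_add_X_pow]

lemma comboMap_injective_of_balanced {A B C M N : ℕ} (hA : A ≤ M) (hB : B ≤ M)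
    (hN : ∀ i < N - (A + B), ∀ j < N - (A + B), (i : F) = j → i = j)
    (h2N : 2 * N ≤ 2 * M + (A + B + C)) (hABC : A ≤ B + C) (hBAC : B ≤ A + C)
    (hS : A + B + C ≤ 2 * M) :
    Function.Injective (comboMap ((X : F[X]) ^ A * (1 + X) ^ C) M (N - M) (N - M)
      (N - (A + B + C))) := by
  refine comboMap_injective fun u hu v hv w hw h => ?_
  obtain ⟨P, rfl⟩ := Nat.exists_eq_add_of_le hA
  obtain ⟨v, rfl⟩ : X ^ A ∣ v :=
    ⟨-(X ^ P * u + (1 + X) ^ C * w), by rw [pow_add] at h; linear_combination h⟩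
  have hXA : (X : F[X]) ^ A ≠ 0 := pow_ne_zero _ X_ne_zero
  have h' : X ^ P * u + v + (1 + X) ^ C * w = 0 := by
    refine (mul_eq_zero.1 ?_).resolve_left hXA
    rw [← h]
    ring
  have hv1 := mem_degreeLT_of_mul_mem hXA hv
  rw [natDegree_X_pow] at hv1
  have hw1 : w ∈ degreeLT F (N - (A + B) - C) := by rwa [Nat.sub_sub]
  have hu1 : u ∈ degreeLT F (N - (A + B) - P) := by
    have hXu : X ^ P * u ∈ degreeLT F (N - (A + B)) := by
      have : X ^ P * u = -(v + (1 + X) ^ C * w) := by linear_combination h'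
      rw [this]
      exact neg_mem (add_mem (degreeLT_mono (by omega) hv1)
        (mul_mem_degreeLT (natDegree_one_add_X_pow C).le hw1))
    simpa using mem_degreeLT_of_mul_mem (pow_ne_zero P X_ne_zero) hXu
  obtain ⟨h1, h2, h3⟩ := eq_zero_of_low_degree_syzygy (Q := A + P - B) hN (by omega) (by omega)
    (by omega) (by omega) hu1 (degreeLT_mono (by omega) hv1) hw1 h'
  simp [h1, h2, h3]

lemma idealPiece_one_add_X_le (A C M S N : ℕ) :
    idealPiece ((X : F[X]) ^ A * (1 + X) ^ (C + 1)) M (S + 1) N ≤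
      idealPiece (X ^ A * (1 + X) ^ C) M S N := by
  intro q hq
  obtain ⟨u, hu, v, hv, w, hw, rfl⟩ := mem_range_comboMap.1 hq
  refine mem_range_comboMap.2 ⟨u, hu, v, hv, (1 + X) * w, ?_, by ring⟩
  refine mul_mem_degreeLT (k := 1) ?_ (by rwa [Nat.sub_sub])
  simpa using (natDegree_one_add_X_pow (F := F) 1).le

lemma mem_degreeLT_min {q : F[X]} {m n : ℕ} (hm : q ∈ degreeLT F m) (hn : q ∈ degreeLT F n) :
    q ∈ degreeLT F (min m n) := by
  rcases min_choice m n with h | h <;> rwa [h]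

lemma idealPiece_eq_of_dominant {A B C M N : ℕ} (hA : A ≤ M) :
    idealPiece ((X : F[X]) ^ A * (1 + X) ^ C) M (A + B + C) N =
      LinearMap.range (comboMap (X ^ A * (1 + X) ^ C) M (N - M) (N - M)
        (min (N - (A + B + C)) (M - A))) := by
  refine le_antisymm ?_ (range_comboMap_le_idealPiece le_rfl le_rfl (min_le_left _ _))
  intro q hq
  obtain ⟨u, hu, v, hv, w, hw, rfl⟩ := mem_range_comboMap.1 hq
  obtain ⟨P, rfl⟩ := Nat.exists_eq_add_of_le hA
  have hmonic : (X ^ P : F[X]).Monic := monic_X_pow P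
  have hdiv : w /ₘ X ^ P ∈ degreeLT F (N - (A + B + C) - P) := by
    rcases eq_or_ne (w /ₘ X ^ P) 0 with h0 | h0
    · rw [h0]; exact zero_mem _
    have hw0 : w ≠ 0 := by rintro rfl; simp at h0
    have hle : ¬ w.degree < (X ^ P : F[X]).degree := fun hlt =>
      h0 ((divByMonic_eq_zero_iff hmonic).2 hlt)
    rw [degree_X_pow, ← natDegree_lt_iff_degree_lt hw0] at hle
    rw [mem_degreeLT_iff_natDegree_lt hw0] at hw
    rw [mem_degreeLT_iff_natDegree_lt h0, natDegree_divByMonic _ hmonic, natDegree_X_pow]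
    omega
  have hsplit : w %ₘ X ^ P + X ^ P * (w /ₘ X ^ P) = w := modByMonic_add_div w _
  refine mem_range_comboMap.2 ⟨u + (1 + X) ^ C * (w /ₘ X ^ P), add_mem hu
    (mul_mem_degreeLT (natDegree_one_add_X_pow C).le (degreeLT_mono (by omega) hdiv)), v, hv,
    w %ₘ X ^ P, ?_, ?_⟩
  · rw [Nat.add_sub_cancel_left]
    refine mem_degreeLT_min ?_
      (mem_degreeLT.2 ((degree_modByMonic_lt w hmonic).trans_eq (degree_X_pow P)))
    rw [← eq_sub_iff_add_eq] at hsplit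
    rw [hsplit]
    exact sub_mem hw (mul_mem_degreeLT (natDegree_X_pow P).le hdiv)
  · rw [pow_add]
    linear_combination X ^ A * (1 + X) ^ C * hsplit

lemma comboMap_injective_of_dominant {A C M i j k : ℕ} (hA : A ≤ M) (hj : j ≤ A)
    (hk : k ≤ M - A) :
    Function.Injective (comboMap ((X : F[X]) ^ A * (1 + X) ^ C) M i j k) := by
  refine comboMap_injective fun u hu v hv w hw h => ?_
  obtain ⟨P, rfl⟩ := Nat.exists_eq_add_of_le hA
  have hv0 : v = 0 := eq_zero_of_X_pow_dvd (degreeLT_mono hj hv)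
    ⟨-(X ^ P * u + (1 + X) ^ C * w), by rw [pow_add] at h; linear_combination h⟩
  subst hv0
  have h' : X ^ P * u + (1 + X) ^ C * w = 0 := by
    refine (mul_eq_zero.1 ?_).resolve_left (pow_ne_zero A X_ne_zero)
    rw [← h]
    ring
  have hcop : IsCoprime ((X : F[X]) ^ P) ((1 + X) ^ C) := isCoprime_X_one_add_X.pow
  have hdvd : X ^ P ∣ w := hcop.dvd_of_dvd_mul_left ⟨-u, by linear_combination h'⟩
  have hw0 : w = 0 := eq_zero_of_X_pow_dvd (degreeLT_mono (by omega) hw) hdvd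
  subst hw0
  simpa [X_ne_zero] using h'

lemma two_mul_sum_range_sub {E k : ℕ} (hk : k ≤ E + 1) :
    2 * ∑ e ∈ Finset.range E, ((e + 1 - k : ℕ) : ℤ) = ((E : ℤ) - k) * (E - k + 1) := by
  induction E with
  | zero =>
    rcases (by omega : k = 0 ∨ k = 1) with rfl | rfl <;> simp
  | succ n ih =>
    rcases hk.lt_or_eq with h | rfl
    · rw [Finset.sum_range_succ, mul_add, ih (by omega), Nat.cast_sub (by omega)]
      push_cast
      ring
    · rw [Finset.sum_eq_zero fun e he => ?_]
      · push_cast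
        ring
      · rw [Finset.mem_range] at he
        simp only [Nat.cast_eq_zero]
        omega

lemma two_mul_sum_range_succ (E : ℕ) :
    2 * ∑ e ∈ Finset.range E, ((e : ℤ) + 1) = (E : ℤ) * (E + 1) := by
  simpa using two_mul_sum_range_sub (Nat.zero_le (E + 1))

theorem finrank_quotient_of_two_mul_le {g : F[X]} {M S : ℕ} (hM : 0 < M) (hg : g.natDegree ≤ S)
    (hS : 2 * M ≤ S) :
    Module.finrank F (MvPolynomial (Fin 2) F ⧸ powIdeal g M S) = M ^ 2 := by
  obtain ⟨E, hE⟩ : ∃ E, 2 * M = E + 1 := ⟨2 * M - 1, by omega⟩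
  have h := finrank_quotient_powIdeal_add hg (hE ▸ degreeLT_two_mul_le_idealPiece (M := M) hg)
  rw [Finset.sum_congr rfl fun e he => show _ = (e + 1 - M) + (e + 1 - M) + 0 from ?_] at h
  · zify at h ⊢
    simp only [add_zero, Finset.sum_add_distrib] at h
    have h1 := two_mul_sum_range_sub (E := E) (k := M) (by omega)
    have h2 := two_mul_sum_range_succ E
    rw [Finset.sum_add_distrib] at h2
    have hE' : (E : ℤ) = 2 * M - 1 := by omega
    rw [hE'] at h1 h2
    linarith
  · rw [Finset.mem_range] at he
    rw [idealPiece, show e + 1 - S = 0 by omega]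
    exact finrank_range_comboMap (comboMap_injective_of_le g (by omega))

theorem finrank_quotient_of_dominant {A B C M : ℕ} (hM : 0 < M) (hA : A ≤ M) (hABC : B + C ≤ A) :
    (Module.finrank F (MvPolynomial (Fin 2) F ⧸
      powIdeal ((X : F[X]) ^ A * (1 + X) ^ C) M (A + B + C)) : ℤ) =
      ((A : ℤ) + B + C) * M - A * (B + C) := by
  have hg : ((X : F[X]) ^ A * (1 + X) ^ C).natDegree ≤ A + B + C := by
    rw [natDegree_X_pow_mul_one_add_X_pow]
    omega
  obtain ⟨E, hE⟩ : ∃ E, M + A = E + 1 := ⟨M + A - 1, by omega⟩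
  have hfull : degreeLT F (E + 1) ≤
      idealPiece ((X : F[X]) ^ A * (1 + X) ^ C) M (A + B + C) (E + 1) :=
    degreeLT_le_idealPiece_of_injective (i := A) (j := A) (k := M - A) hg (by omega) (by omega)
      (by omega) (by omega) (comboMap_injective_of_dominant hA le_rfl le_rfl)
  have h := finrank_quotient_powIdeal_add hg hfull
  have hpiece : ∀ e ∈ Finset.range E,
      Module.finrank F (idealPiece ((X : F[X]) ^ A * (1 + X) ^ C) M (A + B + C) (e + 1)) +
        (e + 1 - (M + B + C)) = (e + 1 - M) + (e + 1 - M) + (e + 1 - (A + B + C)) := by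
    intro e he
    rw [Finset.mem_range] at he
    rw [idealPiece_eq_of_dominant hA, finrank_range_comboMap
      (comboMap_injective_of_dominant hA (by omega) (min_le_right _ _))]
    omega
  have hsum := Finset.sum_congr rfl hpiece
  zify at h hsum
  simp only [Finset.sum_add_distrib] at h hsum
  have h1 := two_mul_sum_range_sub (E := E) (k := M) (by omega)
  have h2 := two_mul_sum_range_succ E
  have h3 := two_mul_sum_range_sub (E := E) (k := A + B + C) (by omega)
  have h4 := two_mul_sum_range_sub (E := E) (k := M + B + C) (by omega)
  rw [Finset.sum_add_distrib] at h2
  have hE' : (E : ℤ) = M + A - 1 := by omega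
  rw [hE'] at h1 h2 h3 h4
  push_cast at h3 h4
  linarith

theorem finrank_quotient_of_balanced {A B C M : ℕ} (hM : 0 < M) (hA : A ≤ M) (hB : B ≤ M)
    (hABC : A < B + C) (hBAC : B < A + C) (hS : A + B + C < 2 * M)
    (hF : ∀ n, 2 * n ≤ 2 * M + C + 1 - (A + B) → ∀ i < n, ∀ j < n, (i : F) = j → i = j) :
    (Module.finrank F (MvPolynomial (Fin 2) F ⧸
      powIdeal ((X : F[X]) ^ A * (1 + X) ^ C) M (A + B + C)) : ℤ) =
      ((A : ℤ) + B + C) * M - ((A : ℤ) + B + C) ^ 2 / 4 := by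
  have hg : ∀ C, ((X : F[X]) ^ A * (1 + X) ^ C).natDegree ≤ A + B + C := fun C => by
    rw [natDegree_X_pow_mul_one_add_X_pow]
    omega
  obtain ⟨E, hE⟩ : ∃ E, M + (A + B + C + 1) / 2 = E + 1 :=
    ⟨M + (A + B + C + 1) / 2 - 1, by omega⟩
  have hfull : degreeLT F (E + 1) ≤
      idealPiece ((X : F[X]) ^ A * (1 + X) ^ C) M (A + B + C) (E + 1) := by
    rcases Nat.even_or_odd (A + B + C) with ⟨m, hm⟩ | ⟨m, hm⟩
    · exact degreeLT_le_idealPiece_of_injective (hg C) le_rfl le_rfl le_rfl (by omega)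
        (comboMap_injective_of_balanced hA hB (hF _ (by omega)) (by omega) (by omega) (by omega)
          (by omega))
    · refine le_trans ?_ (idealPiece_one_add_X_le A C M (A + B + C) (E + 1))
      exact degreeLT_le_idealPiece_of_injective (hg (C + 1)) le_rfl le_rfl le_rfl (by omega)
        (comboMap_injective_of_balanced hA hB (hF _ (by omega)) (by omega) (by omega) (by omega)
          (by omega))
  have h := finrank_quotient_powIdeal_add (hg C) hfull
  rw [Finset.sum_congr rfl fun e he =>
    show _ = (e + 1 - M) + (e + 1 - M) + (e + 1 - (A + B + C)) from ?_] at h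
  · zify at h
    simp only [Finset.sum_add_distrib] at h
    have h1 := two_mul_sum_range_sub (E := E) (k := M) (by omega)
    have h2 := two_mul_sum_range_succ E
    have h3 := two_mul_sum_range_sub (E := E) (k := A + B + C) (by omega)
    rw [Finset.sum_add_distrib] at h2
    rw [show (A : ℤ) + B + C = ((A + B + C : ℕ) : ℤ) by push_cast; rfl]
    rcases Nat.even_or_odd (A + B + C) with ⟨m, hm⟩ | ⟨m, hm⟩
    · have hE' : (E : ℤ) = M + m - 1 := by omega
      rw [hm] at h3
      rw [hm, show (((m + m : ℕ) : ℤ)) ^ 2 / 4 = (m : ℤ) ^ 2 by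
        rw [show (((m + m : ℕ) : ℤ)) ^ 2 = (m : ℤ) ^ 2 * 4 by push_cast; ring]
        exact Int.mul_ediv_cancel _ (by norm_num)]
      rw [hm] at h
      rw [hE'] at h1 h2 h3
      push_cast at h3 ⊢
      linarith
    · have hE' : (E : ℤ) = M + m := by omega
      rw [hm] at h3
      rw [hm, show (((2 * m + 1 : ℕ) : ℤ)) ^ 2 / 4 = (m : ℤ) ^ 2 + m by
        rw [show (((2 * m + 1 : ℕ) : ℤ)) ^ 2 = 4 * ((m : ℤ) ^ 2 + m) + 1 by push_cast; ring]
        omega]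
      rw [hm] at h
      rw [hE'] at h1 h2 h3
      push_cast at h h3 ⊢
      linarith
  · rw [Finset.mem_range] at he
    exact finrank_range_comboMap (comboMap_injective_of_balanced hA hB (hF _ (by omega))
      (by omega) (by omega) (by omega) (by omega))

lemma IKM_eq_powIdeal (a b c M K : ℕ) :
    IKM F a b c M K =
      powIdeal (X ^ (a * K) * (1 + X) ^ (c * K)) M (a * K + b * K + c * K) := by
  rw [IKM, powIdeal, homogenize_eq_of_isHomogeneous
    (q := (MvPolynomial.X 0 ^ a * MvPolynomial.X 1 ^ b *
      (MvPolynomial.X 0 + MvPolynomial.X 1) ^ c) ^ K)]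
  · have h0 := MvPolynomial.isHomogeneous_X F (0 : Fin 2)
    have h1 := MvPolynomial.isHomogeneous_X F (1 : Fin 2)
    have h := (((h0.pow a).mul (h1.pow b)).mul ((h0.add h1).pow c)).pow K
    convert h using 1
    ring
  · simp only [map_pow, map_mul, map_add, MvPolynomial.aeval_X, Matrix.cons_val_zero,
      Matrix.cons_val_one]
    ring

/-- Exchanging the variables exchanges the exponents `a` and `b`. -/
lemma finrank_quotient_IKM_swap (a b c M K : ℕ) :
    Module.finrank F (MvPolynomial (Fin 2) F ⧸ IKM F a b c M K) =
      Module.finrank F (MvPolynomial (Fin 2) F ⧸ IKM F b a c M K) := by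
  refine (Ideal.quotientEquivAlg _ _ (MvPolynomial.renameEquiv F (Equiv.swap (0 : Fin 2) 1))
    ?_).toLinearEquiv.finrank_eq
  rw [IKM, IKM, Ideal.map_span]
  congr 1
  simp only [Set.image_insert_eq, Set.image_singleton]
  simp [add_comm, mul_comm, Set.insert_comm]

end Polynomial

/-- The length `ℓ_{K,M}` of `F[x,y]/(x^M, y^M, (x^a y^b (x+y)^c)^K)`. -/
theorem stmt12 (F : Type*) [Field F] (a b c M K : ℕ) (hM : 1 ≤ M) (hK : 1 ≤ K)
    (haK : a * K ≤ M) (hbK : b * K ≤ M)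
    (hchar : CharP F 0 ∨ ∃ p : ℕ, p.Prime ∧ CharP F p ∧
      min ((M : ℤ) + ((c : ℤ) - a) * K) (min ((M : ℤ) + ((c : ℤ) - b) * K)
        (2 * (M : ℤ) - ((a : ℤ) + b) * K)) ≤ (p : ℤ)) :
    FiniteDimensional F (MvPolynomial (Fin 2) F ⧸ IKM F a b c M K) ∧
    (b + c ≤ a →
      (Module.finrank F (MvPolynomial (Fin 2) F ⧸ IKM F a b c M K) : ℤ)
        = ((a : ℤ) + b + c) * K * M - (a : ℤ) * ((b : ℤ) + c) * K ^ 2) ∧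
    (2 * M ≤ (a + b + c) * K →
      Module.finrank F (MvPolynomial (Fin 2) F ⧸ IKM F a b c M K) = M ^ 2) ∧
    (a + c ≤ b →
      (Module.finrank F (MvPolynomial (Fin 2) F ⧸ IKM F a b c M K) : ℤ)
        = ((a : ℤ) + b + c) * K * M - (b : ℤ) * ((a : ℤ) + c) * K ^ 2) ∧
    (¬ (b + c ≤ a) → ¬ (2 * M ≤ (a + b + c) * K) → ¬ (a + c ≤ b) →
      (Module.finrank F (MvPolynomial (Fin 2) F ⧸ IKM F a b c M K) : ℤ)
        = ((a : ℤ) + b + c) * K * M - ((a : ℤ) + b + c) ^ 2 * (K : ℤ) ^ 2 / 4) := by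
  have hg : ((Polynomial.X : F[X]) ^ (a * K) * (1 + Polynomial.X) ^ (c * K)).natDegree ≤
      a * K + b * K + c * K := by
    rw [Polynomial.natDegree_X_pow_mul_one_add_X_pow]
    omega
  have hdom : ∀ a b, a * K ≤ M → b + c ≤ a →
      (Module.finrank F (MvPolynomial (Fin 2) F ⧸ IKM F a b c M K) : ℤ)
        = ((a : ℤ) + b + c) * K * M - (a : ℤ) * ((b : ℤ) + c) * K ^ 2 := by
    intro a b haK h
    rw [Polynomial.IKM_eq_powIdeal, Polynomial.finrank_quotient_of_dominant hM haK (by nlinarith)]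
    push_cast
    ring
  refine ⟨?_, hdom a b haK, ?_, ?_, ?_⟩
  · rw [Polynomial.IKM_eq_powIdeal]
    refine Polynomial.finiteDimensional_quotient_powIdeal (E := 2 * M - 1) hg ?_
    rw [Nat.sub_add_cancel (by omega)]
    exact Polynomial.degreeLT_two_mul_le_idealPiece hg
  · intro h
    rw [Polynomial.IKM_eq_powIdeal]
    exact Polynomial.finrank_quotient_of_two_mul_le hM hg (by linarith)
  · intro h
    rw [Polynomial.finrank_quotient_IKM_swap, hdom b a hbK h]
    ring
  · intro h1 h2 h3
    push Not at h1 h2 h3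
    have h1' : a * K < b * K + c * K := by nlinarith
    have h3' : b * K < a * K + c * K := by nlinarith
    have h2' : a * K + b * K + c * K < 2 * M := by linarith
    rw [Polynomial.IKM_eq_powIdeal, Polynomial.finrank_quotient_of_balanced hM haK hbK h1' h3' h2']
    · push_cast
      rw [show ((a : ℤ) * K + b * K + c * K) ^ 2 = ((a : ℤ) + b + c) ^ 2 * K ^ 2 by ring]
      ring
    · intro n hn i hi j hj hij
      rcases hchar with h0 | ⟨p, -, hp, hmin⟩
      · have := CharP.charP_to_charZero F
        exact_mod_cast hij
      · have hnp : n ≤ p := by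
          zify at hn h1' h2' h3' ⊢
          simp only [sub_mul, add_mul] at hmin
          omega
        have := (CharP.cast_eq_iff_mod_eq F p).1 hij
        rwa [Nat.mod_eq_of_lt (by omega), Nat.mod_eq_of_lt (by omega)] at this
end

section
/- Let (ψ_n)_{n∈ℕ} be a sequence of functions from [0,1] to ℝ such that each ψ_n is continuous on [0,1], convex on [0,1], non-increasing on [0,1], and satisfies ψ_n(0) = 1 and ψ_n(1) = 0. Let ψ : [0,1] → ℝ be a continuous, non-increasing function with ψ(0) = 1 and ψ(1) = 0. Suppose that for every rational number u ∈ (0,1) there exists a sequence (r_n)_{n∈ℕ} of real numbers such that 0 ≤ r_n ≤ u for all sufficiently large n, r_n → u as n → ∞, and ψ_n(r_n) → ψ(u) as n → ∞. Then the sequence (ψ_n) converges to ψ uniformly on [0,1]; in particular, ψ_n(t) → ψ(t) for every t ∈ [0,1]. -/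
open Filter Set

/-- The values of `ψseq n` along some sequence in `[0, u]` tending to `u` converge to `ψ u`. -/
def LeftApproximable (ψseq : ℕ → ℝ → ℝ) (ψ : ℝ → ℝ) (u : ℝ) : Prop :=
  ∃ r : ℕ → ℝ, (∀ᶠ n in atTop, 0 ≤ r n ∧ r n ≤ u) ∧ Tendsto r atTop (nhds u) ∧
    Tendsto (fun n => ψseq n (r n)) atTop (nhds (ψ u))

section

variable {ψseq : ℕ → ℝ → ℝ} {ψ : ℝ → ℝ} {t ε : ℝ}

/-- Locally uniform upper bound for antitone functions that converge along rational points. -/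
theorem exists_nhdsWithin_eventually_lt_add
    (hmono : ∀ n, AntitoneOn (ψseq n) (Icc 0 1)) (h0 : ∀ n, ψseq n 0 = 1)
    (hψcont : ContinuousOn ψ (Icc 0 1)) (hψ0 : ψ 0 = 1)
    (happrox : ∀ u : ℚ, 0 < u → u < 1 → LeftApproximable ψseq ψ u)
    (ht : t ∈ Icc (0 : ℝ) 1) (hε : 0 < ε) :
    ∃ V ∈ nhdsWithin t (Icc 0 1), ∀ᶠ n in atTop, ∀ s ∈ V, ψseq n s < ψ t + ε := by
  rcases ht.1.eq_or_lt with rfl | htpos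
  · refine ⟨Icc 0 1, self_mem_nhdsWithin, Eventually.of_forall fun n s hs => ?_⟩
    have := hmono n (left_mem_Icc.2 zero_le_one) hs hs.1
    linarith [h0 n]
  · obtain ⟨δ, hδ, hψδ⟩ := Metric.continuousOn_iff.1 hψcont t ht (ε / 2) (half_pos hε)
    obtain ⟨u, hu, hut⟩ := exists_rat_btwn (max_lt htpos (sub_lt_self t hδ))
    obtain ⟨hu0, huδ⟩ := max_lt_iff.1 hu
    have hu1 : (u : ℝ) < 1 := hut.trans_le ht.2
    obtain ⟨r, hr, -, hψr⟩ := happrox u (mod_cast hu0) (mod_cast hu1)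
    have hclose := hψδ u ⟨hu0.le, hu1.le⟩ (by rw [Real.dist_eq, abs_lt]; constructor <;> linarith)
    rw [Real.dist_eq, abs_lt] at hclose
    refine ⟨Icc 0 1 ∩ Ioi (u : ℝ), inter_mem self_mem_nhdsWithin
      (mem_nhdsWithin_of_mem_nhds (Ioi_mem_nhds hut)), ?_⟩
    filter_upwards [hr, hψr.eventually_lt_const (lt_add_of_pos_right _ (half_pos hε))]
      with n hrn hlt s hs
    have := hmono n ⟨hrn.1, hrn.2.trans hu1.le⟩ hs.1 (hrn.2.trans (le_of_lt hs.2))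
    linarith

/-- Locally uniform lower bound for antitone functions that converge along rational points. -/
theorem exists_nhdsWithin_eventually_sub_lt
    (hmono : ∀ n, AntitoneOn (ψseq n) (Icc 0 1)) (h1 : ∀ n, ψseq n 1 = 0)
    (hψcont : ContinuousOn ψ (Icc 0 1)) (hψ1 : ψ 1 = 0)
    (happrox : ∀ u : ℚ, 0 < u → u < 1 → LeftApproximable ψseq ψ u)
    (ht : t ∈ Icc (0 : ℝ) 1) (hε : 0 < ε) :
    ∃ V ∈ nhdsWithin t (Icc 0 1), ∀ᶠ n in atTop, ∀ s ∈ V, ψ t - ε < ψseq n s := by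
  rcases ht.2.eq_or_lt with rfl | htlt
  · refine ⟨Icc 0 1, self_mem_nhdsWithin, Eventually.of_forall fun n s hs => ?_⟩
    have := hmono n hs (right_mem_Icc.2 zero_le_one) hs.2
    linarith [h1 n]
  · obtain ⟨δ, hδ, hψδ⟩ := Metric.continuousOn_iff.1 hψcont t ht (ε / 2) (half_pos hε)
    obtain ⟨u, htu, hu⟩ := exists_rat_btwn (lt_min htlt (lt_add_of_pos_right t hδ))
    obtain ⟨hu1, huδ⟩ := lt_min_iff.1 hu
    have hu0 : (0 : ℝ) < u := ht.1.trans_lt htu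
    obtain ⟨v, htv, hvu⟩ := exists_between htu
    obtain ⟨r, hr, hru, hψr⟩ := happrox u (mod_cast hu0) (mod_cast hu1)
    have hclose := hψδ u ⟨hu0.le, hu1.le⟩ (by rw [Real.dist_eq, abs_lt]; constructor <;> linarith)
    rw [Real.dist_eq, abs_lt] at hclose
    refine ⟨Icc 0 1 ∩ Iio v, inter_mem self_mem_nhdsWithin
      (mem_nhdsWithin_of_mem_nhds (Iio_mem_nhds htv)), ?_⟩
    filter_upwards [hr, hru.eventually_const_lt hvu,
      hψr.eventually_const_lt (sub_lt_self _ (half_pos hε))] with n hrn hvr hlt s hs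
    have := hmono n hs.1 ⟨hrn.1, hrn.2.trans hu1.le⟩ ((le_of_lt hs.2).trans hvr.le)
    linarith

end

/-- A sequence of continuous, convex, non-increasing functions `ψ_n : [0,1] → ℝ` with
`ψ_n(0) = 1`, `ψ_n(1) = 0`, converging suitably along rational points to a continuous
non-increasing limit `ψ`, converges to `ψ` uniformly on `[0,1]`. -/
theorem stmt14 (ψseq : ℕ → ℝ → ℝ) (ψ : ℝ → ℝ)
    (hcont : ∀ n, ContinuousOn (ψseq n) (Set.Icc 0 1))
    (hconv : ∀ n, ConvexOn ℝ (Set.Icc 0 1) (ψseq n))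
    (hmono : ∀ n, AntitoneOn (ψseq n) (Set.Icc 0 1))
    (h0 : ∀ n, ψseq n 0 = 1) (h1 : ∀ n, ψseq n 1 = 0)
    (hψcont : ContinuousOn ψ (Set.Icc 0 1))
    (hψmono : AntitoneOn ψ (Set.Icc 0 1))
    (hψ0 : ψ 0 = 1) (hψ1 : ψ 1 = 0)
    (happrox : ∀ u : ℚ, 0 < u → u < 1 →
      ∃ r : ℕ → ℝ,
        (∀ᶠ n in atTop, 0 ≤ r n ∧ r n ≤ (u : ℝ)) ∧
        Tendsto r atTop (nhds (u : ℝ)) ∧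
        Tendsto (fun n => ψseq n (r n)) atTop (nhds (ψ (u : ℝ)))) :
    TendstoUniformlyOn ψseq ψ atTop (Set.Icc 0 1) ∧
    ∀ t ∈ Set.Icc (0 : ℝ) 1, Tendsto (fun n => ψseq n t) atTop (nhds (ψ t)) := by
  have hunif : TendstoUniformlyOn ψseq ψ atTop (Icc 0 1) := by
    rw [← tendstoLocallyUniformlyOn_iff_tendstoUniformlyOn_of_compact isCompact_Icc,
      Metric.tendstoLocallyUniformlyOn_iff]
    intro ε hε t ht
    obtain ⟨V, hV, hupper⟩ :=
      exists_nhdsWithin_eventually_lt_add hmono h0 hψcont hψ0 happrox ht (half_pos hε)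
    obtain ⟨W, hW, hlower⟩ :=
      exists_nhdsWithin_eventually_sub_lt hmono h1 hψcont hψ1 happrox ht (half_pos hε)
    have hψt := (hψcont t ht).eventually (Metric.ball_mem_nhds (ψ t) (half_pos hε))
    refine ⟨_, inter_mem (inter_mem hV hW) hψt, ?_⟩
    filter_upwards [hupper, hlower] with n hup hlo s hs
    have hψs : dist (ψ s) (ψ t) < ε / 2 := hs.2
    have hup' := hup s hs.1.1
    have hlo' := hlo s hs.1.2
    rw [Real.dist_eq, abs_lt] at hψs ⊢
    constructor <;> linarith
  exact ⟨hunif, fun t ht => hunif.tendsto_at ht⟩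
end

section
/- Let a ≥ b ≥ c ≥ 0 be integers with a ≥ 1 and a ≥ b + c, and let t be a real number with 0 < t < 1/a. For each prime p, let f = x^a y^b (x+y)^c ∈ 𝔽_p[x,y], let r_p = ⌊t·p⌋, and let L_p = dim_{𝔽_p} 𝔽_p[x,y]/(x^p, y^p, f^{r_p}). Then L_p/p² → (a+b+c)t − a(b+c)t² as p → ∞ along primes; that is, for every ε > 0 there exists P such that |L_p/p² − ((a+b+c)t − a(b+c)t²)| < ε for every prime p ≥ P. -/
open MvPolynomial

/-- Length is additive along multiplication by `w`, in the form
`ℓ(R/(wm, v, wg)) = ℓ(R/(w, v)) + ℓ(R/(m, v, g))`. -/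
theorem finrank_quotient_span_mul {k R : Type*} [Field k] [CommRing R] [IsDomain R] [Algebra k R]
    {w m v g : R} (hw : w ≠ 0) (hwv : ∀ β, w ∣ β * v → w ∣ β)
    [Module.Finite k (R ⧸ Ideal.span ({w * m, v} : Set R))] :
    Module.finrank k (R ⧸ Ideal.span ({w * m, v, w * g} : Set R)) =
      Module.finrank k (R ⧸ Ideal.span ({w, v} : Set R)) +
        Module.finrank k (R ⧸ Ideal.span ({m, v, g} : Set R)) := by
  set J := Ideal.span ({w * m, v, w * g} : Set R) with hJ
  set I := Ideal.span ({w, v} : Set R) with hI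
  set K := Ideal.span ({m, v, g} : Set R) with hK
  have hJI : J ≤ I := by
    refine Ideal.span_le.2 ?_
    rintro x (rfl | rfl | rfl)
    · exact I.mul_mem_right _ (Ideal.subset_span (by simp))
    · exact Ideal.subset_span (by simp)
    · exact I.mul_mem_right _ (Ideal.subset_span (by simp))
  have hfin : Module.Finite k (R ⧸ J) := by
    have hle : Ideal.span ({w * m, v} : Set R) ≤ J := Ideal.span_mono (by
      rintro x (rfl | rfl) <;> simp)
    exact Module.Finite.of_surjective (Ideal.Quotient.factorₐ k hle).toLinearMap
      (Ideal.Quotient.factor_surjective hle)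
  let π : (R ⧸ J) →ₗ[k] (R ⧸ I) := (Ideal.Quotient.factorₐ k hJI).toLinearMap
  have hπ : Function.Surjective π := Ideal.Quotient.factor_surjective hJI
  let μ : R →ₗ[k] (R ⧸ J) := (Ideal.Quotient.mkₐ k J).toLinearMap ∘ₗ LinearMap.mulLeft k w
  have hμ (h : R) : μ h = Ideal.Quotient.mk J (w * h) := rfl
  have hrange : LinearMap.range μ = LinearMap.ker π := by
    ext x
    constructor
    · rintro ⟨h, rfl⟩
      change Ideal.Quotient.mk I (w * h) = 0
      exact Ideal.Quotient.eq_zero_iff_mem.2 (I.mul_mem_right _ (Ideal.subset_span (by simp)))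
    · obtain ⟨f, rfl⟩ := Ideal.Quotient.mk_surjective x
      intro hf
      obtain ⟨s, q, rfl⟩ :=
        Ideal.mem_span_pair.1
          (Ideal.Quotient.eq_zero_iff_mem.1 (show Ideal.Quotient.mk I f = 0 from hf))
      refine ⟨s, ?_⟩
      rw [hμ, Ideal.Quotient.eq]
      have : w * s - (s * w + q * v) = (-q) * v := by ring
      rw [this]
      exact J.mul_mem_left _ (Ideal.subset_span (by simp))
  have hker : LinearMap.ker μ = K.restrictScalars k := by
    ext h
    rw [LinearMap.mem_ker, hμ, Ideal.Quotient.eq_zero_iff_mem, Submodule.restrictScalars_mem]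
    constructor
    · intro hh
      obtain ⟨α, z, hz, h1⟩ := Ideal.mem_span_insert.1 hh
      obtain ⟨β, γ, rfl⟩ := Ideal.mem_span_pair.1 hz
      obtain ⟨β', rfl⟩ := hwv β ⟨h - α * m - γ * g, by linear_combination -h1⟩
      have : h = α * m + (β' * v + γ * g) := mul_left_cancel₀ hw (by linear_combination h1)
      rw [this]
      exact Ideal.mem_span_insert.2 ⟨α, _, Ideal.mem_span_pair.2 ⟨β', γ, rfl⟩, rfl⟩
    · intro hh
      obtain ⟨α, z, hz, rfl⟩ := Ideal.mem_span_insert.1 hh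
      obtain ⟨β, γ, rfl⟩ := Ideal.mem_span_pair.1 hz
      exact Ideal.mem_span_insert.2
        ⟨α, _, Ideal.mem_span_pair.2 ⟨w * β, γ, rfl⟩, by ring⟩
  have h1 := LinearMap.finrank_range_add_finrank_ker π
  rw [LinearMap.range_eq_top.2 hπ, finrank_top, ← hrange] at h1
  rw [← h1, ← μ.quotKerEquivRange.finrank_eq, (Submodule.quotEquivOfEq _ _ hker).finrank_eq]
  rfl

namespace Polynomial

variable {k : Type*} [Field k]

/-- `ℓ(k[x,y]/(x^M, g)) = M · deg_y g` when `g` is monic in `y`. -/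
theorem finrank_quotient_span_C_X_pow_of_monic (M : ℕ) {g : k[X][X]} (hg : g.Monic) :
    Module.finrank k (k[X][X] ⧸ Ideal.span ({C (X ^ M), g} : Set k[X][X])) =
      M * g.natDegree := by
  rcases Nat.eq_zero_or_pos M with rfl | hM
  · have : Ideal.span ({C (X ^ 0), g} : Set k[X][X]) = ⊤ :=
      (Ideal.eq_top_iff_one _).2 (Ideal.subset_span (by simp))
    have : Subsingleton (k[X][X] ⧸ Ideal.span ({C (X ^ 0), g} : Set k[X][X])) :=
      Ideal.Quotient.subsingleton_iff.2 this
    rw [Module.finrank_zero_of_subsingleton, zero_mul]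
  set I := Ideal.span ({X ^ M} : Set k[X]) with hI
  have hS : Module.finrank k (k[X] ⧸ I) = M := by
    rw [finrank_quotient_span_eq_natDegree, natDegree_X_pow]
  have : Nontrivial (k[X] ⧸ I) := Module.nontrivial_of_finrank_pos (R := k) (by omega)
  let q := g.map (Ideal.Quotient.mk I)
  have hq : q.Monic := hg.map _
  have hqd : q.natDegree = g.natDegree := hg.natDegree_map _
  let φ : k[X][X] →ₐ[k] AdjoinRoot q :=
    ((AdjoinRoot.mkₐ q).restrictScalars k).comp (mapAlgHom (Ideal.Quotient.mkₐ k I))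
  have hφ (f : k[X][X]) : φ f = AdjoinRoot.mk q (f.map (Ideal.Quotient.mk I)) := rfl
  have hsurj : Function.Surjective φ := by
    intro z
    obtain ⟨f, rfl⟩ := Ideal.Quotient.mk_surjective z
    obtain ⟨f', rfl⟩ := map_surjective (Ideal.Quotient.mk I) Ideal.Quotient.mk_surjective f
    exact ⟨f', rfl⟩
  have hker : RingHom.ker φ = Ideal.span ({C (X ^ M), g} : Set k[X][X]) := by
    apply le_antisymm
    · intro f hf
      rw [RingHom.mem_ker, hφ, AdjoinRoot.mk_eq_zero] at hf
      obtain ⟨h, hh⟩ := hf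
      obtain ⟨h', rfl⟩ := map_surjective (Ideal.Quotient.mk I) Ideal.Quotient.mk_surjective h
      have h2 : f - g * h' ∈ RingHom.ker (mapRingHom (Ideal.Quotient.mk I)) := by
        rw [RingHom.mem_ker, coe_mapRingHom, Polynomial.map_sub, Polynomial.map_mul, hh, sub_self]
      rw [ker_mapRingHom, Ideal.mk_ker, hI, Ideal.map_span, Set.image_singleton,
        Ideal.mem_span_singleton'] at h2
      obtain ⟨s, hs⟩ := h2
      exact Ideal.mem_span_pair.2 ⟨s, h', by linear_combination hs⟩
    · refine Ideal.span_le.2 ?_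
      rintro x (rfl | rfl)
      · have : Ideal.Quotient.mk I (X ^ M) = 0 :=
          Ideal.Quotient.eq_zero_iff_mem.2 (Ideal.mem_span_singleton_self _)
        rw [SetLike.mem_coe, RingHom.mem_ker, hφ, map_C, this, C_0, map_zero]
      · rw [SetLike.mem_coe, RingHom.mem_ker, hφ]
        exact AdjoinRoot.mk_self
  have hfree : Module.Free (k[X] ⧸ I) (AdjoinRoot q) := hq.free_adjoinRoot
  rw [← hker, (Ideal.quotientKerAlgEquivOfSurjective hsurj).toLinearEquiv.finrank_eq,
    ← Module.finrank_mul_finrank k (k[X] ⧸ I) (AdjoinRoot q), hS,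
    (AdjoinRoot.powerBasis' hq).finrank, AdjoinRoot.powerBasis'_dim, hqd]

/-- `ℓ(k[x,y]/(x^N, y^N, x^A y^B (x+y)^D))` for `A ≤ N` and `B + D ≤ A`. -/
theorem finrank_quotient_span_pow_pow_mul {N A B D : ℕ} (hN : 0 < N) (hAN : A ≤ N)
    (hBD : B + D ≤ A) :
    Module.finrank k (k[X][X] ⧸ Ideal.span ({C X ^ N, X ^ N,
      C X ^ A * (X ^ B * (C X + X) ^ D)} : Set k[X][X])) = A * N + (N - A) * (B + D) := by
  set x : k[X][X] := C X with hx
  set g : k[X][X] := X ^ B * (x + X) ^ D with hg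
  have hmon : (x + X : k[X][X]).Monic := by rw [add_comm]; exact monic_X_add_C _
  have hgm : g.Monic := (monic_X_pow B).mul (hmon.pow D)
  have hdeg : g.natDegree = B + D := by
    rw [hg, (monic_X_pow B).natDegree_mul (hmon.pow D), natDegree_X_pow, hmon.natDegree_pow,
      add_comm x, hx, natDegree_X_add_C, mul_one]
  have hxN : x ^ N = x ^ A * x ^ (N - A) := by rw [← pow_add, Nat.add_sub_cancel' hAN]
  have hxC (M : ℕ) : x ^ M = C (X ^ M) := by rw [hx, C_pow]
  have hfin : Module.Finite k (k[X][X] ⧸ Ideal.span ({x ^ A * x ^ (N - A), X ^ N} :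
      Set k[X][X])) := by
    apply Module.finite_of_finrank_pos
    rw [← hxN, hxC, finrank_quotient_span_C_X_pow_of_monic N (monic_X_pow N), natDegree_X_pow]
    positivity
  have hcancel (β : k[X][X]) (h : x ^ A ∣ β * X ^ N) : x ^ A ∣ β := by
    rw [hxC, C_dvd_iff_dvd_coeff] at h ⊢
    intro i
    simpa only [coeff_mul_X_pow] using h (i + N)
  have hmem : X ^ N ∈ Ideal.span ({x ^ (N - A), g} : Set k[X][X]) := by
    have h1 : (X : k[X][X]) ^ (N - B) ∈ Ideal.span ({x ^ (N - A), (x + X) ^ D} : Set k[X][X]) := by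
      rw [show (X : k[X][X]) ^ (N - B) = (-1 * x + (x + X)) ^ (N - B) by ring]
      refine Ideal.add_pow_mem_of_pow_mem_of_le (m := N - A) (n := D) _ ?_ ?_ (by omega)
      · rw [mul_pow]
        exact Ideal.mul_mem_left _ _ (Ideal.subset_span (by simp))
      · exact Ideal.subset_span (by simp)
    obtain ⟨s, q, hsq⟩ := Ideal.mem_span_pair.1 h1
    refine Ideal.mem_span_pair.2 ⟨X ^ B * s, q, ?_⟩
    rw [show (X : k[X][X]) ^ N = X ^ B * X ^ (N - B) by
      rw [← pow_add, Nat.add_sub_cancel' (by omega)], ← hsq, hg]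
    ring
  have hspan : Ideal.span ({x ^ (N - A), X ^ N, g} : Set k[X][X]) =
      Ideal.span ({C (X ^ (N - A)), g} : Set k[X][X]) := by
    rw [Set.insert_comm, ← hxC]
    exact Submodule.span_insert_eq_span hmem
  rw [hxN, finrank_quotient_span_mul (pow_ne_zero _ (by simp [hx])) hcancel, hspan, hxC,
    finrank_quotient_span_C_X_pow_of_monic _ hgm, hdeg,
    finrank_quotient_span_C_X_pow_of_monic _ (monic_X_pow N), natDegree_X_pow]

end Polynomial

namespace MvPolynomial

/-- `ℓ(k[x,y]/(x^N, y^N, (x^a y^b (x+y)^c)^r))` for `a r ≤ N` and `b + c ≤ a`. -/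
theorem finrank_quotient_span_pow_pow_pow {k : Type*} [Field k] {a b c r N : ℕ} (hN : 0 < N)
    (har : a * r ≤ N) (hbca : b + c ≤ a) :
    Module.finrank k (MvPolynomial (Fin 2) k ⧸ Ideal.span ({X 0 ^ N, X 1 ^ N,
      (X 0 ^ a * X 1 ^ b * (X 0 + X 1) ^ c) ^ r} : Set (MvPolynomial (Fin 2) k))) =
      a * r * N + (N - a * r) * ((b + c) * r) := by
  have h := Polynomial.finrank_quotient_span_pow_pow_mul (k := k) (B := b * r) (D := c * r) hN har
    (by rw [← add_mul]; exact Nat.mul_le_mul_right r hbca)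
  rw [add_mul b c r, ← h]
  refine (Ideal.quotientEquivAlg _ _
    (Polynomial.Bivariate.equivMvPolynomial k).symm ?_).toLinearEquiv.finrank_eq
  rw [Ideal.map_span]
  congr 1
  simp only [Set.image_insert_eq, Set.image_singleton]
  simp [mul_pow, ← pow_mul, mul_assoc]

end MvPolynomial

/-- The limit of `ℓ(𝔽_p[x,y]/(x^p, y^p, f^{⌊tp⌋}))/p²` as `p → ∞` along primes, for
`f = x^a y^b (x+y)^c` with `a ≥ b ≥ c ≥ 0`, `a ≥ 1`, `a ≥ b + c`, and `0 < t < 1/a`. -/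
theorem stmt15 (a b c : ℕ) (hba : b ≤ a) (hcb : c ≤ b) (ha : 1 ≤ a) (hbca : b + c ≤ a)
    (t : ℝ) (ht0 : 0 < t) (ht1 : t < 1 / (a : ℝ)) :
    ∀ ε : ℝ, 0 < ε → ∃ P : ℕ, ∀ p : ℕ, P ≤ p → p.Prime →
      |(Module.finrank (ZMod p) (MvPolynomial (Fin 2) (ZMod p) ⧸
          Ideal.span ({X 0 ^ p, X 1 ^ p,
            (X 0 ^ a * X 1 ^ b * (X 0 + X 1) ^ c) ^ (⌊t * (p : ℝ)⌋₊)} :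
            Set (MvPolynomial (Fin 2) (ZMod p)))) : ℝ) / (p : ℝ) ^ 2
        - (((a : ℝ) + b + c) * t - (a : ℝ) * ((b : ℝ) + c) * t ^ 2)| < ε := by
  intro ε hε
  have hlim := (tendsto_nat_floor_mul_div_atTop ht0.le).comp (tendsto_natCast_atTop_atTop (R := ℝ))
  have hlim2 := (hlim.const_mul ((a : ℝ) + b + c)).sub
    ((hlim.pow 2).const_mul ((a : ℝ) * ((b : ℝ) + c)))
  obtain ⟨P, hP⟩ := Metric.tendsto_atTop.1 hlim2 ε hε
  refine ⟨P, fun p hp hprime => ?_⟩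
  have : Fact p.Prime := ⟨hprime⟩
  have hp0 : (0 : ℝ) < p := by exact_mod_cast hprime.pos
  have ha0 : (0 : ℝ) < a := by exact_mod_cast ha
  have har : a * ⌊t * (p : ℝ)⌋₊ ≤ p := by
    have h1 : (⌊t * (p : ℝ)⌋₊ : ℝ) ≤ t * p := Nat.floor_le (by positivity)
    have h2 : a * t < 1 := by rwa [lt_div_iff₀ ha0, mul_comm] at ht1
    have h3 : (a : ℝ) * ⌊t * (p : ℝ)⌋₊ ≤ p := by nlinarith
    exact_mod_cast h3
  have key := hP p hp
  rw [Real.dist_eq] at key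
  rw [finrank_quotient_span_pow_pow_pow hprime.pos har hbca]
  convert key using 3
  push_cast [Nat.cast_sub har]
  simp only [Function.comp]
  field_simp
  ring
end

section
/- Let a ≥ b ≥ c ≥ 0 be integers with a ≥ 1 and a < b + c, and let t be a real number with 0 < t < 2/(a+b+c). For each prime p, let f = x^a y^b (x+y)^c ∈ 𝔽_p[x,y], let r_p = ⌊t·p⌋, and let L_p = dim_{𝔽_p} 𝔽_p[x,y]/(x^p, y^p, f^{r_p}). Then L_p/p² → (a+b+c)t − (a+b+c)²t²/4 as p → ∞ along primes; that is, for every ε > 0 there exists P such that |L_p/p² − ((a+b+c)t − (a+b+c)²t²/4)| < ε for every prime p ≥ P. -/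
open MvPolynomial

namespace Polynomial

variable {K : Type*} [Field K] {p : ℕ}

theorem natDegree_eq_zero_of_derivative_eq_zero_of_lt [CharP K p] {f : K[X]}
    (hf : derivative f = 0) (hlt : f.natDegree < p) : f.natDegree = 0 := by
  by_contra h0
  have h := congrArg (coeff · (f.natDegree - 1)) hf
  simp only [coeff_derivative, coeff_zero] at h
  rw [Nat.sub_add_cancel (Nat.pos_of_ne_zero h0), mul_eq_zero] at h
  rcases h with h | h
  · rw [coeff_natDegree, leadingCoeff_eq_zero] at h
    simp [h] at h0
  · have h' : ((f.natDegree : ℕ) : K) = 0 := by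
      rw [← h]
      have : f.natDegree = f.natDegree - 1 + 1 := by omega
      conv_lhs => rw [this]
      push_cast
      ring
    rw [CharP.cast_eq_zero_iff K p] at h'
    exact h0 (Nat.eq_zero_of_dvd_of_lt h' hlt)

theorem exists_C_mul_eq_of_wronskian_eq_zero [CharP K p] {F G : K[X]} (hF : F ≠ 0) (hG : G ≠ 0)
    (hFp : F.natDegree < p) (hGp : G.natDegree < p) (hW : wronskian F G = 0) :
    ∃ v : K, v ≠ 0 ∧ G = C v * F := by
  obtain ⟨Q, F₁, G₁, hcop, hF₁, hG₁⟩ : ∃ Q F₁ G₁ : K[X],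
      IsCoprime F₁ G₁ ∧ F = Q * F₁ ∧ G = Q * G₁ := by
    classical
    obtain ⟨F₁, G₁, hF₁, hG₁, hu⟩ := extract_gcd F G
    exact ⟨gcd F G, F₁, G₁, (gcd_isUnit_iff F₁ G₁).mp hu, hF₁, hG₁⟩
  have hQ : Q ≠ 0 := by rintro h; simp [h] at hF₁; exact hF hF₁
  have hF0 : F₁ ≠ 0 := by rintro rfl; simp at hF₁; exact hF hF₁
  have hG0 : G₁ ≠ 0 := by rintro rfl; simp at hG₁; exact hG hG₁
  subst hF₁ hG₁
  have hW₁ : wronskian F₁ G₁ = 0 := by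
    have h : wronskian (Q * F₁) (Q * G₁) = Q ^ 2 * wronskian F₁ G₁ := by
      simp only [wronskian, derivative_mul]
      ring
    rw [h] at hW
    exact (mul_eq_zero.mp hW).resolve_left (pow_ne_zero 2 hQ)
  obtain ⟨h1, h2⟩ := hcop.wronskian_eq_zero_iff.mp hW₁
  rw [natDegree_mul hQ hF0] at hFp
  rw [natDegree_mul hQ hG0] at hGp
  obtain ⟨u, rfl⟩ := natDegree_eq_zero.mp
    (natDegree_eq_zero_of_derivative_eq_zero_of_lt h1 (by omega))
  obtain ⟨v, rfl⟩ := natDegree_eq_zero.mp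
    (natDegree_eq_zero_of_derivative_eq_zero_of_lt h2 (by omega))
  rw [Ne, C_eq_zero] at hF0 hG0
  refine ⟨v / u, div_ne_zero hG0 hF0, ?_⟩
  rw [mul_left_comm, ← C_mul, div_mul_cancel₀ _ hF0]

/-- If `A + B + C = 2 * m` with `A, B, C ≤ m < p`, then a nonzero polynomial of degree less than
`p - m` has a product with `X ^ A * (1 + X) ^ C` not all of whose coefficients in degrees
`m, …, p - 1` vanish. -/
theorem eq_zero_of_coeff_X_pow_mul_one_add_X_pow_mul_eq_zero [Fact p.Prime] [CharP K p]
    {A B C m : ℕ} (hD : A + B + C = 2 * m) (hA : A ≤ m) (hB : B ≤ m) (hC : C ≤ m)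
    {q : K[X]} (hq : q.natDegree + m < p)
    (h : ∀ i, m ≤ i → i < p → (X ^ A * (1 + X) ^ C * q).coeff i = 0) : q = 0 := by
  have hX1 : (1 + X : K[X]) = X + Polynomial.C 1 := by simp [add_comm]
  have hmon : (1 + X : K[X]).Monic := hX1 ▸ monic_X_add_C 1
  have hdeg : ((1 + X : K[X]) ^ C).natDegree = C := by
    rw [hX1, natDegree_pow, natDegree_X_add_C, mul_one]
  have hmul : ∀ f : K[X], X ^ A * (1 + X) ^ C * f = 0 → f = 0 := fun f hf =>
    (mul_eq_zero.mp hf).resolve_left ((monic_X_pow A).mul (hmon.pow C)).ne_zero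
  have hcop : ∀ i j : ℕ, IsCoprime ((X : K[X]) ^ i) ((1 + X) ^ j) := fun i j =>
    IsCoprime.pow ⟨-1, 1, by ring⟩
  set P := X ^ A * (1 + X) ^ C * q with hP
  have hPdeg : P.natDegree + B + 1 ≤ p + m := by
    have h1 := natDegree_mul_le (p := X ^ A * (1 + X : K[X]) ^ C) (q := q)
    rw [← hP] at h1
    have h2 := natDegree_mul_le (p := (X : K[X]) ^ A) (q := (1 + X) ^ C)
    rw [hdeg, natDegree_X_pow] at h2
    omega
  set G := ∑ i ∈ Finset.range m, monomial i (P.coeff i) with hG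
  have hGcoeff : ∀ n, G.coeff n = if n < m then P.coeff n else 0 := by
    intro n
    simp [hG, finsetSum_coeff, coeff_monomial]
  have hGdeg : G ≠ 0 → G.natDegree < m := by
    intro hG0
    by_contra hlt
    have := hGcoeff G.natDegree
    rw [if_neg hlt, coeff_natDegree, leadingCoeff_eq_zero] at this
    exact hG0 this
  obtain ⟨F, hF⟩ : X ^ p ∣ P - G := by
    rw [X_pow_dvd_iff]
    intro i hi
    rw [coeff_sub, hGcoeff]
    split_ifs with him
    · simp
    · rw [h i (by omega) hi, sub_zero]
  have hFdeg : F ≠ 0 → F.natDegree + B < m := by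
    intro hF0
    have h1 := natDegree_sub_le P G
    rw [hF, natDegree_mul (pow_ne_zero _ X_ne_zero) hF0, natDegree_X_pow, le_max_iff] at h1
    rcases eq_or_ne G 0 with hG0 | hG0
    · simp only [hG0, natDegree_zero] at h1
      omega
    · have := hGdeg hG0
      omega
  have hPFG : P = X ^ p * F + G := by rw [← hF]; ring
  have hXG : X ^ A ∣ G := by
    have h1 : X ^ A ∣ P := by rw [hP, mul_assoc]; exact dvd_mul_right _ _
    rw [hPFG] at h1
    exact (dvd_add_right ((pow_dvd_pow X (by omega : A ≤ p)).mul_right F)).mp h1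
  have hXGF : (1 + X) ^ C ∣ G - F := by
    have h1 : (1 + X) ^ C ∣ P := by
      rw [hP, mul_assoc]; exact (dvd_mul_right _ _).mul_left _
    have h2 : P = (1 + X) ^ p * F + (G - F) := by
      rw [hPFG, add_pow_char, one_pow]; ring
    rw [h2] at h1
    exact (dvd_add_right ((pow_dvd_pow (1 + X) (by omega : C ≤ p)).mul_right F)).mp h1
  have hW : wronskian F G = 0 := by
    by_contra hW
    have hF0 : F ≠ 0 := by rintro h; simp [h] at hW
    have hG0 : G ≠ 0 := by rintro h; simp [h] at hW
    have h1 : X ^ (A - 1) ∣ wronskian F G :=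
      dvd_sub ((pow_sub_one_dvd_derivative_of_pow_dvd hXG).mul_left _)
        (((pow_dvd_pow X (Nat.sub_le A 1)).trans hXG).mul_left _)
    have h2 : (1 + X) ^ (C - 1) ∣ wronskian F G := by
      have h3 : wronskian F G = F * derivative (G - F) - derivative F * (G - F) := by
        rw [wronskian, derivative_sub]; ring
      rw [h3]
      exact dvd_sub ((pow_sub_one_dvd_derivative_of_pow_dvd hXGF).mul_left _)
        (((pow_dvd_pow _ (Nat.sub_le C 1)).trans hXGF).mul_left _)
    have h3 := natDegree_le_of_dvd ((hcop _ _).mul_dvd h1 h2) hW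
    rw [natDegree_mul (pow_ne_zero _ X_ne_zero) (pow_ne_zero _ hmon.ne_zero), natDegree_X_pow,
      hX1, natDegree_pow, natDegree_X_add_C] at h3
    have := natDegree_wronskian_lt_add hW
    have := hFdeg hF0
    have := hGdeg hG0
    omega
  have hnat : ∀ {f : K[X]}, f ≠ 0 → (1 + X) ^ C ∣ f → C ≤ f.natDegree := fun hf hdvd =>
    hdeg ▸ natDegree_le_of_dvd hdvd hf
  rcases eq_or_ne F 0 with hF0 | hF0
  · rcases eq_or_ne G 0 with hG0 | hG0
    · exact hmul q (by rw [← hP, hPFG, hF0, hG0]; simp)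
    · rw [hF0, sub_zero] at hXGF
      have h3 := natDegree_le_of_dvd ((hcop _ _).mul_dvd hXG hXGF) hG0
      rw [natDegree_mul (pow_ne_zero _ X_ne_zero) (pow_ne_zero _ hmon.ne_zero), natDegree_X_pow,
        hdeg] at h3
      have := hGdeg hG0
      omega
  · have hFm := hFdeg hF0
    rcases eq_or_ne G 0 with hG0 | hG0
    · rw [hG0, zero_sub, dvd_neg] at hXGF
      have := hnat hF0 hXGF
      omega
    · have := hGdeg hG0
      obtain ⟨v, hv, hGv⟩ := exists_C_mul_eq_of_wronskian_eq_zero hF0 hG0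
        (by omega) (by omega) hW
      have hXF : X ^ A ∣ F := by
        rw [hGv] at hXG
        exact (isUnit_C.mpr hv.isUnit).dvd_mul_left.mp hXG
      have := natDegree_le_of_dvd hXF hF0
      rw [natDegree_X_pow] at this
      omega

theorem exists_coeff_X_pow_mul_one_add_X_pow_mul_eq [Fact p.Prime] [CharP K p]
    {A B C m : ℕ} (hD : A + B + C = 2 * m) (hA : A ≤ m) (hB : B ≤ m) (hC : C ≤ m)
    (hm : m < p) (w : ℕ → K) :
    ∃ q : K[X], q.natDegree + m < p ∧
      ∀ i, m ≤ i → i < p → (X ^ A * (1 + X) ^ C * q).coeff i = w i := by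
  let θ : degreeLT K (p - m) →ₗ[K] (Fin (p - m) → K) :=
    (LinearMap.pi fun i : Fin (p - m) => lcoeff K (m + i)) ∘ₗ
      LinearMap.mulLeft K (X ^ A * (1 + X) ^ C : K[X]) ∘ₗ (degreeLT K (p - m)).subtype
  have hnat : ∀ q ∈ degreeLT K (p - m), q.natDegree + m < p := by
    intro q hq
    rw [mem_degreeLT] at hq
    rcases eq_or_ne q 0 with rfl | hq0
    · simpa using hm
    · have := (natDegree_lt_iff_degree_lt hq0).mpr hq
      omega
  have hinj : Function.Injective θ := by
    rw [← LinearMap.ker_eq_bot, LinearMap.ker_eq_bot']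
    rintro ⟨q, hq⟩ h
    rw [Submodule.mk_eq_zero]
    refine eq_zero_of_coeff_X_pow_mul_one_add_X_pow_mul_eq_zero hD hA hB hC (hnat q hq) ?_
    intro i hi hip
    have := congrFun h ⟨i - m, by omega⟩
    simpa [θ, mul_assoc, Nat.add_sub_cancel' hi] using this
  have hfin : Module.finrank K (degreeLT K (p - m)) = Module.finrank K (Fin (p - m) → K) :=
    (degreeLTEquiv K (p - m)).finrank_eq
  have : FiniteDimensional K (degreeLT K (p - m)) :=
    Module.Finite.equiv (degreeLTEquiv K (p - m)).symm
  obtain ⟨⟨q, hq⟩, h⟩ :=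
    (LinearMap.injective_iff_surjective_of_finrank_eq_finrank hfin).mp hinj
      fun i => w (m + i)
  refine ⟨q, hnat q hq, fun i hi hip => ?_⟩
  have := congrFun h ⟨i - m, by omega⟩
  simpa [θ, mul_assoc, Nat.add_sub_cancel' hi] using this
end Polynomial

namespace MvPolynomial
variable {K : Type*} [Field K]

/-- The exponent vector of `x ^ i * y ^ j`. -/
noncomputable def biexp (i j : ℕ) : Fin 2 →₀ ℕ := Finsupp.single 0 i + Finsupp.single 1 j

@[simp] theorem biexp_zero (i j : ℕ) : biexp i j 0 = i := by simp [biexp]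

@[simp] theorem biexp_one (i j : ℕ) : biexp i j 1 = j := by simp [biexp]

theorem biexp_eta (s : Fin 2 →₀ ℕ) : biexp (s 0) (s 1) = s := by
  ext i; fin_cases i <;> simp

/-- The injective ring homomorphism `x ↦ X * T`, `y ↦ T` into `K[X][T]`, which sends the
homogeneous component of degree `n` to the coefficient of `T ^ n`. -/
noncomputable def dehomogenize : MvPolynomial (Fin 2) K →ₐ[K] Polynomial (Polynomial K) :=
  aeval ![Polynomial.C Polynomial.X * Polynomial.X, Polynomial.X]

theorem dehomogenize_monomial (s : Fin 2 →₀ ℕ) (r : K) :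
    dehomogenize (monomial s r) =
      Polynomial.monomial (s 0 + s 1) (Polynomial.monomial (s 0) r) := by
  rw [dehomogenize, aeval_monomial, Finsupp.prod_fintype _ _ (by simp), Fin.prod_univ_two]
  simp only [Matrix.cons_val_zero, Matrix.cons_val_one]
  rw [← Polynomial.C_mul_X_pow_eq_monomial, ← Polynomial.C_mul_X_pow_eq_monomial,
    IsScalarTower.algebraMap_apply K (Polynomial K) (Polynomial (Polynomial K))]
  simp only [Polynomial.algebraMap_eq, map_mul, map_pow]
  ring

theorem coeff_coeff_dehomogenize (f : MvPolynomial (Fin 2) K) (i j : ℕ) :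
    ((dehomogenize f).coeff (i + j)).coeff i = f.coeff (biexp i j) := by
  induction f using MvPolynomial.induction_on' with
  | monomial s r =>
    rw [dehomogenize_monomial, Polynomial.coeff_monomial, coeff_monomial]
    by_cases h : s = biexp i j
    · simp [h]
    · rw [if_neg h]
      split_ifs with h'
      · rw [Polynomial.coeff_monomial, if_neg]
        rintro h0
        apply h
        rw [← biexp_eta s, h0, show s 1 = j by omega]
      · simp
  | add f g hf hg => simp [hf, hg]

theorem natDegree_coeff_dehomogenize_le (f : MvPolynomial (Fin 2) K) (n : ℕ) :
    ((dehomogenize f).coeff n).natDegree ≤ n := by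
  induction f using MvPolynomial.induction_on' with
  | monomial s r =>
    rw [dehomogenize_monomial, Polynomial.coeff_monomial]
    split_ifs with h
    · exact (Polynomial.natDegree_monomial_le r).trans (by omega)
    · simp
  | add f g hf hg =>
    rw [map_add, Polynomial.coeff_add]
    exact (Polynomial.natDegree_add_le _ _).trans (max_le hf hg)

theorem dehomogenize_mul (A B C : ℕ) (f : MvPolynomial (Fin 2) K) :
    dehomogenize (X 0 ^ A * X 1 ^ B * (X 0 + X 1) ^ C * f) =
      Polynomial.C (Polynomial.X ^ A * (1 + Polynomial.X) ^ C) * dehomogenize f *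
        Polynomial.X ^ (A + B + C) := by
  have h0 : dehomogenize (X 0 : MvPolynomial (Fin 2) K) =
      Polynomial.C Polynomial.X * Polynomial.X := by simp [dehomogenize]
  have h1 : dehomogenize (X 1 : MvPolynomial (Fin 2) K) = Polynomial.X := by
    simp [dehomogenize]
  simp only [map_mul, map_pow, map_add, h0, h1, map_one]
  have h2 : (Polynomial.C (Polynomial.X : Polynomial K) * Polynomial.X + Polynomial.X) ^ C =
      (1 + Polynomial.C (Polynomial.X : Polynomial K)) ^ C * Polynomial.X ^ C := by
    rw [← mul_pow]
    congr 1
    ring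
  rw [h2]
  ring

theorem coeff_dehomogenize_mul (A B C n : ℕ) (f : MvPolynomial (Fin 2) K) :
    (dehomogenize (X 0 ^ A * X 1 ^ B * (X 0 + X 1) ^ C * f)).coeff (n + (A + B + C)) =
      Polynomial.X ^ A * (1 + Polynomial.X) ^ C * (dehomogenize f).coeff n := by
  rw [dehomogenize_mul, Polynomial.coeff_mul_X_pow, Polynomial.coeff_C_mul]

theorem coeff_dehomogenize_eq_zero {f : MvPolynomial (Fin 2) K} {n : ℕ}
    (hf : ∀ i j, i + j = n → f.coeff (biexp i j) = 0) : (dehomogenize f).coeff n = 0 := by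
  ext k
  rw [Polynomial.coeff_zero]
  rcases le_or_gt k n with hk | hk
  · obtain ⟨l, rfl⟩ := Nat.exists_eq_add_of_le hk
    rw [coeff_coeff_dehomogenize]
    exact hf _ _ rfl
  · exact Polynomial.coeff_eq_zero_of_natDegree_lt
      ((natDegree_coeff_dehomogenize_le f n).trans_lt hk)

theorem coeff_mul_eq_zero_of_lt (A B C : ℕ) (f : MvPolynomial (Fin 2) K) {N i j : ℕ}
    (hf : ∀ i j, i + j < N → f.coeff (biexp i j) = 0) (h : i + j < N + (A + B + C)) :
    (X 0 ^ A * X 1 ^ B * (X 0 + X 1) ^ C * f).coeff (biexp i j) = 0 := by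
  rw [← coeff_coeff_dehomogenize]
  rcases lt_or_ge (i + j) (A + B + C) with hlt | hge
  · rw [dehomogenize_mul, Polynomial.coeff_mul_X_pow', if_neg (by omega), Polynomial.coeff_zero]
  · obtain ⟨n, hn⟩ := Nat.exists_eq_add_of_le' hge
    rw [hn, coeff_dehomogenize_mul, coeff_dehomogenize_eq_zero, mul_zero, Polynomial.coeff_zero]
    exact fun i j hij => hf i j (by omega)

theorem coeff_mul_eq_zero_of_le (A B C : ℕ) (f : MvPolynomial (Fin 2) K) {N i j : ℕ}
    (hf : ∀ i j, N ≤ i + j → f.coeff (biexp i j) = 0) (h : N + (A + B + C) ≤ i + j) :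
    (X 0 ^ A * X 1 ^ B * (X 0 + X 1) ^ C * f).coeff (biexp i j) = 0 := by
  rw [← coeff_coeff_dehomogenize]
  obtain ⟨n, hn⟩ := Nat.exists_eq_add_of_le' (show A + B + C ≤ i + j by omega)
  rw [hn, coeff_dehomogenize_mul, coeff_dehomogenize_eq_zero, mul_zero, Polynomial.coeff_zero]
  exact fun i j hij => hf i j (by omega)

/-- The linear map recording the coefficients of the monomials `x ^ i * y ^ j` with
`i, j < p`; its kernel is the ideal `(x ^ p, y ^ p)`. -/
noncomputable def boxCoeff (K : Type*) [Field K] (p : ℕ) :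
    MvPolynomial (Fin 2) K →ₗ[K] (Fin p × Fin p → K) :=
  LinearMap.pi fun x => lcoeff K (biexp x.1 x.2)

@[simp] theorem boxCoeff_apply (p : ℕ) (f : MvPolynomial (Fin 2) K) (x : Fin p × Fin p) :
    boxCoeff K p f x = f.coeff (biexp x.1 x.2) := rfl

theorem boxCoeff_mul_X_pow (p : ℕ) (k : Fin 2) (f : MvPolynomial (Fin 2) K) :
    boxCoeff K p (f * X k ^ p) = 0 := by
  ext ⟨i, j⟩
  rw [boxCoeff_apply, X_pow_eq_monomial, coeff_mul_monomial', if_neg, Pi.zero_apply]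
  intro h
  have := h k
  fin_cases k
  · simp at this; omega
  · simp at this; omega

theorem mem_span_of_boxCoeff_eq_zero {p : ℕ} {f : MvPolynomial (Fin 2) K}
    (hf : boxCoeff K p f = 0) : f ∈ Ideal.span {X 0 ^ p, X 1 ^ p} := by
  rw [f.as_sum]
  refine Ideal.sum_mem _ fun s hs => ?_
  have key : ∀ k, p ≤ s k → monomial s (f.coeff s) ∈
      Ideal.span {X 0 ^ p, X 1 ^ p} := by
    intro k hk
    have h1 : monomial s (f.coeff s) =
        monomial (s - Finsupp.single k p) (f.coeff s) * X k ^ p := by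
      rw [X_pow_eq_monomial, monomial_mul, mul_one, tsub_add_cancel_of_le]
      simpa using hk
    rw [h1]
    refine Ideal.mul_mem_left _ _ (Ideal.subset_span ?_)
    fin_cases k <;> simp
  by_cases h0 : p ≤ s 0
  · exact key 0 h0
  by_cases h1 : p ≤ s 1
  · exact key 1 h1
  have := congrFun hf (⟨s 0, by omega⟩, ⟨s 1, by omega⟩)
  rw [boxCoeff_apply, biexp_eta, Pi.zero_apply] at this
  rw [this, monomial_zero]
  exact Ideal.zero_mem _

theorem boxCoeff_surjective (p : ℕ) : Function.Surjective (boxCoeff K p) := by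
  intro z
  refine ⟨∑ x, monomial (biexp x.1 x.2) (z x), ?_⟩
  ext y
  rw [boxCoeff_apply, coeff_sum, Finset.sum_eq_single y]
  · simp
  · intro x _ hxy
    rw [coeff_monomial, if_neg]
    intro h
    apply hxy
    have h0 := DFunLike.congr_fun h 0
    have h1 := DFunLike.congr_fun h 1
    simp only [biexp_zero, biexp_one] at h0 h1
    exact Prod.ext (Fin.ext h0) (Fin.ext h1)
  · simp

theorem finrank_quotient_add_finrank_range (p : ℕ) (g : MvPolynomial (Fin 2) K) :
    Module.finrank K (MvPolynomial (Fin 2) K ⧸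
        Ideal.span ({X 0 ^ p, X 1 ^ p, g} : Set (MvPolynomial (Fin 2) K))) +
      Module.finrank K (LinearMap.range (boxCoeff K p ∘ₗ LinearMap.mulLeft K g)) = p ^ 2 := by
  set I := Ideal.span ({X 0 ^ p, X 1 ^ p, g} : Set (MvPolynomial (Fin 2) K))
  set V := LinearMap.range (boxCoeff K p ∘ₗ LinearMap.mulLeft K g)
  have hker : LinearMap.ker (V.mkQ ∘ₗ boxCoeff K p) = I.restrictScalars K := by
    ext f
    simp only [LinearMap.mem_ker, LinearMap.comp_apply, Submodule.mkQ_apply,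
      Submodule.Quotient.mk_eq_zero, Submodule.restrictScalars_mem]
    constructor
    · rintro ⟨h, hh⟩
      have h1 : f - g * h ∈ Ideal.span {X 0 ^ p, X 1 ^ p} := by
        apply mem_span_of_boxCoeff_eq_zero
        rw [map_sub, ← hh]
        simp
      have h2 : f - g * h ∈ I := Ideal.span_mono (by intro x; simp; tauto) h1
      have h3 : g * h ∈ I := Ideal.mul_mem_right _ _ (Ideal.subset_span (by simp))
      simpa using I.add_mem h2 h3
    · intro hf
      obtain ⟨a, z, hz, rfl⟩ := Ideal.mem_span_insert.mp hf
      obtain ⟨b, w, hw, rfl⟩ := Ideal.mem_span_insert.mp hz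
      obtain ⟨h, rfl⟩ := Ideal.mem_span_singleton.mp hw
      refine ⟨h, ?_⟩
      simp only [LinearMap.comp_apply, LinearMap.mulLeft_apply, map_add, boxCoeff_mul_X_pow,
        zero_add]
  have hsurj : Function.Surjective (V.mkQ ∘ₗ boxCoeff K p) :=
    V.mkQ_surjective.comp (boxCoeff_surjective p)
  have e1 := (LinearMap.quotKerEquivOfSurjective _ hsurj).finrank_eq
  rw [hker] at e1
  have e2 := (Submodule.Quotient.restrictScalarsEquiv K I).finrank_eq
  rw [← e2, e1, Submodule.finrank_quotient_add_finrank, Module.finrank_fintype_fun_eq_card]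
  simp [sq]

/-- The pairs of natural numbers with sum less than `n`. -/
def simplex (n : ℕ) : Finset (ℕ × ℕ) := (Finset.range n).biUnion Finset.HasAntidiagonal.antidiagonal

@[simp] theorem mem_simplex {n : ℕ} {x : ℕ × ℕ} : x ∈ simplex n ↔ x.1 + x.2 < n := by
  simp [simplex]

theorem card_simplex (n : ℕ) : 2 * (simplex n).card = n * (n + 1) := by
  rw [simplex, Finset.card_biUnion]
  · simp only [Finset.Nat.card_antidiagonal]
    induction n with
    | zero => simp
    | succ n ih => rw [Finset.sum_range_succ, mul_add, ih]; ring
  · intro i _ j _ hij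
    rw [Function.onFun, Finset.disjoint_left]
    intro x hx hx'
    rw [Finset.HasAntidiagonal.mem_antidiagonal] at hx hx'
    omega

/-- The polynomial of total degree less than `n` with prescribed coefficients. -/
noncomputable def ofSimplex (K : Type*) [Field K] (n : ℕ) :
    (simplex n → K) →ₗ[K] MvPolynomial (Fin 2) K :=
  ∑ x, monomial (biexp x.1.1 x.1.2) ∘ₗ LinearMap.proj x

theorem coeff_ofSimplex (n : ℕ) (u : simplex n → K) (i j : ℕ) :
    (ofSimplex K n u).coeff (biexp i j) =
      if h : i + j < n then u ⟨(i, j), mem_simplex.mpr h⟩ else 0 := by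
  have key : ∀ x : simplex n, (monomial (biexp x.1.1 x.1.2) (u x)).coeff (biexp i j) =
      if x.1 = (i, j) then u x else 0 := by
    intro x
    rw [coeff_monomial]
    refine if_congr ⟨fun h => ?_, fun h => by rw [h]⟩ rfl rfl
    have h0 := DFunLike.congr_fun h 0
    have h1 := DFunLike.congr_fun h 1
    simp only [biexp_zero, biexp_one] at h0 h1
    exact Prod.ext h0 h1
  simp only [ofSimplex, LinearMap.coe_sum, Finset.sum_apply, LinearMap.comp_apply,
    LinearMap.proj_apply, coeff_sum, key]
  split_ifs with h
  · rw [Finset.sum_eq_single ⟨(i, j), mem_simplex.mpr h⟩]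
    · simp
    · intro x _ hx
      exact if_neg fun h' => hx (Subtype.ext h')
    · simp
  · refine Finset.sum_eq_zero fun x _ => if_neg fun h' => h ?_
    have := mem_simplex.mp x.2
    rwa [h'] at this

/-- The vector supported on the indices `(p - 1 - i, p - 1 - j)` with `i + j < M`. -/
def corner (K : Type*) [Field K] (p M : ℕ) : (simplex M → K) →ₗ[K] (Fin p × Fin p → K) where
  toFun v x := if h : (p - 1 - x.1) + (p - 1 - x.2) < M then
    v ⟨(p - 1 - x.1, p - 1 - x.2), mem_simplex.mpr h⟩ else 0
  map_add' v w := by ext x; simp only [Pi.add_apply]; split_ifs <;> simp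
  map_smul' r v := by ext x; simp

theorem corner_apply (p M : ℕ) (v : simplex M → K) (x : Fin p × Fin p) :
    corner K p M v x = if h : (p - 1 - x.1) + (p - 1 - x.2) < M then
      v ⟨(p - 1 - x.1, p - 1 - x.2), mem_simplex.mpr h⟩ else 0 := rfl

/-- The image of the ideal generated by `x ^ A * y ^ B * (x + y) ^ C` in
`K[x, y] / (x ^ p, y ^ p)`. -/
noncomputable def boxImage (K : Type*) [Field K] (p A B C : ℕ) :
    Submodule K (Fin p × Fin p → K) :=
  LinearMap.range (boxCoeff K p ∘ₗ LinearMap.mulLeft K (X 0 ^ A * X 1 ^ B * (X 0 + X 1) ^ C))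

theorem boxImage_succ_le (p A B C : ℕ) : boxImage K p (A + 1) B C ≤ boxImage K p A B C := by
  rintro _ ⟨f, rfl⟩
  refine ⟨X 0 * f, ?_⟩
  simp only [LinearMap.comp_apply, LinearMap.mulLeft_apply]
  congr 1
  ring

theorem finrank_boxImage_le {p A B C m : ℕ} (hm : m < p) (hD : 2 * m ≤ A + B + C + 1) :
    Module.finrank K (boxImage K p A B C) ≤ (p - m) * (p - m + 1) := by
  set g : MvPolynomial (Fin 2) K := X 0 ^ A * X 1 ^ B * (X 0 + X 1) ^ C
  let Λ : (simplex (p - m) → K) × (simplex (p - m) → K) →ₗ[K] (Fin p × Fin p → K) :=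
    LinearMap.coprod (boxCoeff K p ∘ₗ LinearMap.mulLeft K g ∘ₗ ofSimplex K (p - m))
      (corner K p (p - m))
  have hle : boxImage K p A B C ≤ LinearMap.range Λ := by
    rintro _ ⟨f, rfl⟩
    let u : simplex (p - m) → K := fun x => f.coeff (biexp x.1.1 x.1.2)
    let v : simplex (p - m) → K := fun x =>
      (g * (f - ofSimplex K _ u)).coeff (biexp (p - 1 - x.1.1) (p - 1 - x.1.2))
    have hlow : ∀ i j, i + j < p - m → (f - ofSimplex K _ u).coeff (biexp i j) = 0 := by
      intro i j hij
      rw [coeff_sub, coeff_ofSimplex, dif_pos hij, sub_self]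
    have hv : corner K p _ v = boxCoeff K p (g * (f - ofSimplex K _ u)) := by
      ext ⟨i, j⟩
      rw [corner_apply, boxCoeff_apply]
      split_ifs with h
      · have hi : p - 1 - (p - 1 - (i : ℕ)) = i := by omega
        have hj : p - 1 - (p - 1 - (j : ℕ)) = j := by omega
        simp only [v, hi, hj]
      · refine (coeff_mul_eq_zero_of_lt A B C _ hlow ?_).symm
        simp only at h ⊢
        omega
    refine ⟨(u, v), ?_⟩
    simp only [Λ, LinearMap.coprod_apply, LinearMap.comp_apply, LinearMap.mulLeft_apply, hv,
      ← map_add, ← mul_add]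
    rw [add_sub_cancel]
  refine (Submodule.finrank_mono hle).trans (Λ.finrank_range_le.trans ?_)
  rw [Module.finrank_prod, Module.finrank_fintype_fun_eq_card, Fintype.card_coe, ← two_mul,
    card_simplex]

section CharP

variable {p : ℕ} [Fact p.Prime] [CharP K p] {A B C m : ℕ}

theorem coeff_eq_zero_of_coeff_mul_eq_zero (hD : A + B + C = 2 * m) (hA : A ≤ m) (hB : B ≤ m)
    (hC : C ≤ m) {f : MvPolynomial (Fin 2) K}
    (hf : boxCoeff K p (X 0 ^ A * X 1 ^ B * (X 0 + X 1) ^ C * f) = 0) {i j : ℕ}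
    (hij : i + j + m < p) : f.coeff (biexp i j) = 0 := by
  rw [← coeff_coeff_dehomogenize]
  have hdeg := natDegree_coeff_dehomogenize_le f (i + j)
  rw [Polynomial.eq_zero_of_coeff_X_pow_mul_one_add_X_pow_mul_eq_zero hD hA hB hC
    (q := (dehomogenize f).coeff (i + j)) (by omega) ?_, Polynomial.coeff_zero]
  intro k hk hkp
  rw [← coeff_dehomogenize_mul A B C]
  rcases le_or_gt k (i + j + (A + B + C)) with hle | hlt
  · obtain ⟨l, hl⟩ := Nat.exists_eq_add_of_le hle
    rw [hl, coeff_coeff_dehomogenize]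
    exact congrFun hf (⟨k, hkp⟩, ⟨l, by omega⟩)
  · exact Polynomial.coeff_eq_zero_of_natDegree_lt
      ((natDegree_coeff_dehomogenize_le _ _).trans_lt hlt)

theorem single_mem_boxImage (hD : A + B + C = 2 * m) (hA : A ≤ m) (hB : B ≤ m)
    (hC : C ≤ m) (hm : m < p) (x : Fin p × Fin p) (hx : p - 1 + m ≤ x.1 + x.2) (r : K) :
    Pi.single x r ∈ boxImage K p A B C := by
  obtain ⟨i, j⟩ := x
  simp only at hx
  obtain ⟨q, hq, hcoeff⟩ := Polynomial.exists_coeff_X_pow_mul_one_add_X_pow_mul_eq (K := K)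
    hD hA hB hC hm (fun k => if k = i then r else 0)
  obtain ⟨n, hn⟩ := Nat.exists_eq_add_of_le' (show A + B + C ≤ (i : ℕ) + j by omega)
  have hh : dehomogenize (∑ k ∈ Finset.range (n + 1), monomial (biexp k (n - k)) (q.coeff k)) =
      Polynomial.monomial n q := by
    rw [map_sum]
    conv_rhs => rw [q.as_sum_range' (n + 1) (by omega), map_sum]
    refine Finset.sum_congr rfl fun k hk => ?_
    rw [Finset.mem_range] at hk
    rw [dehomogenize_monomial, biexp_zero, biexp_one, Nat.add_sub_cancel' (by omega)]
  refine ⟨∑ k ∈ Finset.range (n + 1), monomial (biexp k (n - k)) (q.coeff k), ?_⟩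
  ext ⟨i', j'⟩
  rw [LinearMap.comp_apply, LinearMap.mulLeft_apply, boxCoeff_apply, ← coeff_coeff_dehomogenize,
    dehomogenize_mul, hh, Polynomial.C_mul_monomial, Polynomial.monomial_mul_X_pow,
    Polynomial.coeff_monomial, Pi.single_apply]
  simp only [Prod.mk.injEq, Fin.ext_iff]
  split_ifs with h1 h2 h2
  · rw [hcoeff _ (by omega) i'.2, if_pos h2.1]
  · rw [hcoeff _ (by omega) i'.2, if_neg (by omega)]
  · omega
  · simp

theorem le_finrank_boxImage (hD : A + B + C = 2 * m) (hA : A ≤ m) (hB : B ≤ m)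
    (hC : C ≤ m) (hm : m < p) : (p - m) ^ 2 ≤ Module.finrank K (boxImage K p A B C) := by
  set g : MvPolynomial (Fin 2) K := X 0 ^ A * X 1 ^ B * (X 0 + X 1) ^ C
  let Λ : (simplex (p - m - 1) → K) × (simplex (p - m) → K) →ₗ[K] (Fin p × Fin p → K) :=
    LinearMap.coprod (boxCoeff K p ∘ₗ LinearMap.mulLeft K g ∘ₗ ofSimplex K (p - m - 1))
      (corner K p (p - m))
  have hle : LinearMap.range Λ ≤ boxImage K p A B C := by
    rintro _ ⟨⟨u, v⟩, rfl⟩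
    refine Submodule.add_mem _ ⟨ofSimplex K _ u, rfl⟩ ?_
    simp only [LinearMap.comp_apply, LinearMap.snd_apply]
    rw [← Finset.univ_sum_single (corner K p (p - m) v)]
    refine Submodule.sum_mem _ fun x _ => ?_
    rw [corner_apply]
    split_ifs with h
    · exact single_mem_boxImage hD hA hB hC hm x (by omega) _
    · rw [Pi.single_zero]
      exact Submodule.zero_mem _
  have hinj : Function.Injective Λ := by
    rw [← LinearMap.ker_eq_bot, LinearMap.ker_eq_bot']
    rintro ⟨u, v⟩ huv
    have hcoeff : ∀ x : Fin p × Fin p, (g * ofSimplex K _ u).coeff (biexp x.1 x.2) +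
        corner K p (p - m) v x = 0 := fun x => congrFun huv x
    have hhigh : ∀ i j, p - m - 1 ≤ i + j → (ofSimplex K _ u).coeff (biexp i j) = 0 := by
      intro i j hij
      rw [coeff_ofSimplex, dif_neg (by omega)]
    have hv : v = 0 := by
      ext ⟨⟨i, j⟩, hx⟩
      have hx' := mem_simplex.mp hx
      simp only at hx'
      have h := hcoeff (⟨p - 1 - i, by omega⟩, ⟨p - 1 - j, by omega⟩)
      rw [coeff_mul_eq_zero_of_le A B C _ hhigh (by simp only; omega), zero_add,
        corner_apply, dif_pos (by simp only; omega)] at h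
      have hi : p - 1 - (p - 1 - i) = i := by omega
      have hj : p - 1 - (p - 1 - j) = j := by omega
      simpa only [hi, hj, Pi.zero_apply] using h
    have hu : u = 0 := by
      ext ⟨⟨i, j⟩, hx⟩
      have hx' := mem_simplex.mp hx
      simp only at hx'
      have h := coeff_eq_zero_of_coeff_mul_eq_zero (p := p) hD hA hB hC
        (f := ofSimplex K _ u) (by
          ext x
          have := hcoeff x
          rwa [hv, map_zero, Pi.zero_apply, add_zero] at this) (i := i) (j := j) (by omega)
      rwa [coeff_ofSimplex, dif_pos hx'] at h
    rw [hu, hv]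
    rfl
  refine le_trans (le_of_eq ?_) (Submodule.finrank_mono hle)
  rw [LinearMap.finrank_range_of_inj hinj, Module.finrank_prod,
    Module.finrank_fintype_fun_eq_card, Module.finrank_fintype_fun_eq_card, Fintype.card_coe,
    Fintype.card_coe]
  have h1 := card_simplex (p - m)
  have h2 := card_simplex (p - m - 1)
  obtain ⟨n, hn⟩ : ∃ n, p - m = n + 1 := ⟨p - m - 1, by omega⟩
  rw [hn] at h1 h2 ⊢
  simp only [Nat.add_sub_cancel] at h1 h2 ⊢
  nlinarith

/-- For `D = A + B + C`, the colength of `(x ^ p, y ^ p, x ^ A * y ^ B * (x + y) ^ C)` differs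
from `p ^ 2 - (p - ⌈D / 2⌉) ^ 2` by at most `p - ⌈D / 2⌉`. -/
theorem finrank_quotient_bounds (hD : A + B + C = 2 * m ∨ A + B + C + 1 = 2 * m)
    (hA : A ≤ B + C) (hB : B ≤ A + C) (hC : C ≤ A + B) (hm : m < p) :
    Module.finrank K (MvPolynomial (Fin 2) K ⧸
        Ideal.span ({X 0 ^ p, X 1 ^ p, X 0 ^ A * X 1 ^ B * (X 0 + X 1) ^ C} :
          Set (MvPolynomial (Fin 2) K))) + (p - m) ^ 2 ≤ p ^ 2 ∧
    p ^ 2 ≤ Module.finrank K (MvPolynomial (Fin 2) K ⧸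
        Ideal.span ({X 0 ^ p, X 1 ^ p, X 0 ^ A * X 1 ^ B * (X 0 + X 1) ^ C} :
          Set (MvPolynomial (Fin 2) K))) + (p - m) * (p - m + 1) := by
  have h := finrank_quotient_add_finrank_range (K := K) p (X 0 ^ A * X 1 ^ B * (X 0 + X 1) ^ C)
  have hupper := finrank_boxImage_le (K := K) (A := A) (B := B) (C := C) hm (by omega)
  have hlower : (p - m) ^ 2 ≤ Module.finrank K (boxImage K p A B C) := by
    rcases hD with hD | hD
    · exact le_finrank_boxImage hD (by omega) (by omega) (by omega) hm
    · exact (le_finrank_boxImage (A := A + 1) (by omega) (by omega) (by omega) (by omega)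
        hm).trans (Submodule.finrank_mono (boxImage_succ_le p A B C))
  rw [boxImage] at hupper hlower
  omega

end CharP

end MvPolynomial

/-- A number `L` within `p` of `p ^ 2 - (p - m) ^ 2`, where `2 * m` is close to `D * p`, is close to
`(D - D ^ 2 / 4) * p ^ 2`. -/
theorem abs_sub_le_of_close {D L p m k : ℝ} (hD0 : 0 ≤ D) (hD2 : D ≤ 2) (hp : 1 ≤ p)
    (hL₁ : L + (p - m) ^ 2 ≤ p ^ 2) (hL₂ : p ^ 2 ≤ L + (p - m) ^ 2 + p)
    (hm : |2 * m - D * p| ≤ k) :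
    |L / p ^ 2 - (D - D ^ 2 / 4)| ≤ (1 + k + k ^ 2) / p := by
  obtain ⟨e, he⟩ : ∃ e, e = 2 * m - D * p := ⟨_, rfl⟩
  have hm' : m = (D * p + e) / 2 := by rw [he]; ring
  rw [← he] at hm
  have hk : 0 ≤ k := (abs_nonneg e).trans hm
  have hsq : e ^ 2 ≤ k ^ 2 := sq_le_sq' (abs_le.mp hm).1 (abs_le.mp hm).2
  have hpe : |p * e * (1 - D / 2)| ≤ p * k := by
    rw [abs_mul, abs_mul, abs_of_nonneg (by linarith : (0 : ℝ) ≤ p)]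
    have h1 : |1 - D / 2| ≤ 1 := abs_le.mpr ⟨by linarith, by linarith⟩
    have h2 : |e| * |1 - D / 2| ≤ k * 1 := mul_le_mul hm h1 (abs_nonneg _) hk
    nlinarith
  have hkey : |L - (D - D ^ 2 / 4) * p ^ 2| ≤ (1 + k + k ^ 2) * p := by
    have h1 : p ^ 2 - (p - m) ^ 2 = (D - D ^ 2 / 4) * p ^ 2 + p * e * (1 - D / 2) - e ^ 2 / 4 := by
      rw [hm']; ring
    have h2 := abs_le.mp hpe
    have h3 : k ^ 2 ≤ k ^ 2 * p := le_mul_of_one_le_right (sq_nonneg k) hp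
    rw [abs_le]
    constructor <;> nlinarith [sq_nonneg e]
  have hp0 : 0 < p := by linarith
  have h1 : L / p ^ 2 - (D - D ^ 2 / 4) = (L - (D - D ^ 2 / 4) * p ^ 2) / p ^ 2 := by
    field_simp
  rw [h1, abs_div, abs_of_pos (by positivity : 0 < p ^ 2), div_le_div_iff₀ (by positivity) hp0]
  nlinarith

/-- The limit of `ℓ(𝔽_p[x,y]/(x^p, y^p, f^{⌊tp⌋}))/p²` as `p → ∞` along primes, for
`f = x^a y^b (x+y)^c` with `a ≥ b ≥ c ≥ 0`, `a ≥ 1`, `a < b + c`, and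
`0 < t < 2/(a+b+c)`. -/
theorem stmt16 (a b c : ℕ) (hba : b ≤ a) (hcb : c ≤ b) (ha : 1 ≤ a) (hbca : a < b + c)
    (t : ℝ) (ht0 : 0 < t) (ht1 : t < 2 / ((a : ℝ) + b + c)) :
    ∀ ε : ℝ, 0 < ε → ∃ P : ℕ, ∀ p : ℕ, P ≤ p → p.Prime →
      |(Module.finrank (ZMod p) (MvPolynomial (Fin 2) (ZMod p) ⧸
          Ideal.span ({X 0 ^ p, X 1 ^ p,
            (X 0 ^ a * X 1 ^ b * (X 0 + X 1) ^ c) ^ (⌊t * (p : ℝ)⌋₊)} :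
            Set (MvPolynomial (Fin 2) (ZMod p)))) : ℝ) / (p : ℝ) ^ 2
        - (((a : ℝ) + b + c) * t - ((a : ℝ) + b + c) ^ 2 * t ^ 2 / 4)| < ε := by
  intro ε hε
  have hs : (0 : ℝ) < a + b + c := by
    have : (1 : ℝ) ≤ a := by exact_mod_cast ha
    positivity
  set s : ℝ := (a : ℝ) + b + c with hs_def
  have hst : s * t < 2 := by rw [lt_div_iff₀ hs] at ht1; linarith
  set k : ℝ := s + 1 with hk
  obtain ⟨P₁, hP₁⟩ := exists_nat_gt ((1 + k + k ^ 2) / ε)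
  obtain ⟨P₂, hP₂⟩ := exists_nat_gt (1 / (2 - s * t))
  refine ⟨max P₁ P₂, fun p hp hprime => ?_⟩
  have : Fact p.Prime := ⟨hprime⟩
  have hp1 : (1 : ℝ) ≤ p := by exact_mod_cast hprime.one_le
  have hp0 : (0 : ℝ) < p := by linarith
  have hpP₁ : (P₁ : ℝ) ≤ p := by exact_mod_cast (le_max_left _ _).trans hp
  have hpP₂ : (P₂ : ℝ) ≤ p := by exact_mod_cast (le_max_right _ _).trans hp
  set r := ⌊t * (p : ℝ)⌋₊
  have hr₁ : (r : ℝ) ≤ t * p := Nat.floor_le (by positivity)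
  have hr₂ : t * p < r + 1 := Nat.lt_floor_add_one _
  obtain ⟨m, hm⟩ : ∃ m, a * r + b * r + c * r = 2 * m ∨ a * r + b * r + c * r + 1 = 2 * m :=
    ⟨(a * r + b * r + c * r + 1) / 2, by omega⟩
  have hm₁ : s * r ≤ 2 * m := by
    have : a * r + b * r + c * r ≤ 2 * m := by omega
    have : (a : ℝ) * r + b * r + c * r ≤ 2 * m := by exact_mod_cast this
    rw [hs_def]; linarith
  have hm₂ : 2 * m ≤ s * r + 1 := by
    have : 2 * m ≤ a * r + b * r + c * r + 1 := by omega
    have : 2 * (m : ℝ) ≤ a * r + b * r + c * r + 1 := by exact_mod_cast this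
    rw [hs_def]; linarith
  have hsr₁ : s * r ≤ s * t * p := by nlinarith
  have hsr₂ : s * t * p ≤ s * r + s := by nlinarith
  have hmp : m < p := by
    have h1 : 1 < p * (2 - s * t) := by
      rw [← div_lt_iff₀ (by linarith)]
      linarith
    have : (m : ℝ) < p := by linarith
    exact_mod_cast this
  have hbounds := finrank_quotient_bounds (K := ZMod p) (p := p) hm
    (by nlinarith) (by nlinarith) (by nlinarith) hmp
  rw [mul_pow, mul_pow, ← pow_mul, ← pow_mul, ← pow_mul]
  generalize Module.finrank (ZMod p) (MvPolynomial (Fin 2) (ZMod p) ⧸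
    Ideal.span ({X 0 ^ p, X 1 ^ p, X 0 ^ (a * r) * X 1 ^ (b * r) * (X 0 + X 1) ^ (c * r)} :
      Set (MvPolynomial (Fin 2) (ZMod p)))) = L at hbounds ⊢
  obtain ⟨hL₁, hL₂⟩ := hbounds
  have hcast : ((p - m : ℕ) : ℝ) = p - m := Nat.cast_sub hmp.le
  have hL₁' : (L : ℝ) + (p - m) ^ 2 ≤ p ^ 2 := by rw [← hcast]; exact_mod_cast hL₁
  have hL₂' : (p : ℝ) ^ 2 ≤ L + (p - m) ^ 2 + p := by
    have : (p : ℝ) ^ 2 ≤ L + (p - m) * (p - m + 1) := by rw [← hcast]; exact_mod_cast hL₂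
    have := m.cast_nonneg (α := ℝ)
    linarith
  have h := abs_sub_le_of_close (by positivity) hst.le hp1 hL₁' hL₂'
    (abs_le.mpr ⟨by linarith, by linarith⟩ : |2 * (m : ℝ) - s * t * p| ≤ k)
  rw [← mul_pow]
  refine h.trans_lt ?_
  rw [div_lt_iff₀ hε] at hP₁
  rw [div_lt_iff₀ hp0]
  nlinarith
end
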